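/- Let G = (𝒢, Ω, v₀) be a game with Nature played on a finite arena with an ω-regular winning condition Ω. Then Éloïse has a topologically-good strategy if and only if she has a finite-memory strategy φ_E such that for every finite-memory strategy φ_A of Abélard the set Outcomes(v₀, φ_E, φ_A) \ Ω of losing plays for Éloïse is meager in the tree T(v₀, φ_E, φ_A). -/

import Mathlib

open Cardinal

/-- The three players: Éloïse, Abélard and Nature. -/
inductive Player : Type
  | E
  | A
  | N
  deriving DecidableEq

/-- An arena: a directed graph without dead-ends whose vertices are
partitioned among the three players (via the `owner` function). -/
structure Arena (V : Type) where
  Edge : V → V → Prop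
  owner : V → Player
  no_dead : ∀ v, ∃ w, Edge v w

/-- The history `[p 0, …, p i]` of a play `p` up to time `i`. -/
def histUpTo {V : Type} (p : ℕ → V) (i : ℕ) : List V :=
  List.ofFn (fun j : Fin (i + 1) => p j.1)

/-- A play from `v0`: an infinite sequence following edges. -/
def IsPlay {V : Type} (A : Arena V) (v0 : V) (p : ℕ → V) : Prop :=
  p 0 = v0 ∧ ∀ i, A.Edge (p i) (p (i + 1))

/-- The player `P` respects the strategy `φ` along the play `p`. -/
def Respects {V : Type} (A : Arena V) (P : Player) (φ : List V → V) (p : ℕ → V) : Prop :=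
  ∀ i, A.owner (p i) = P → p (i + 1) = φ (histUpTo p i)

/-- `φ` is a strategy for player `P`: on every history ending in a vertex of `P`
it prescribes a successor of that vertex. -/
def IsStrategyFor {V : Type} (A : Arena V) (P : Player) (φ : List V → V) : Prop :=
  ∀ (l : List V) (v : V), A.owner v = P → A.Edge v (φ (l ++ [v]))

/-- The set of plays from `v0` in which Éloïse respects `φE` and Abélard respects `φA`
(Nature is unconstrained). -/
def Outcomes {V : Type} (A : Arena V) (v0 : V) (φE φA : List V → V) : Set (ℕ → V) :=
  {p | IsPlay A v0 p ∧ Respects A Player.E φE p ∧ Respects A Player.A φA p}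

/-- `l` is a (finite) prefix of the infinite word `p`. -/
def BPrefix {X : Type} (p : ℕ → X) (l : List X) : Prop :=
  ∀ i : Fin l.length, p i.1 = l.get i
/-- A positional strategy only depends on the current vertex. -/
def PositionalF {V α : Type} (φ : List V → α) : Prop :=
  ∃ f : V → α, ∀ (l : List V) (v : V), φ (l ++ [v]) = f v

/-- A finite-memory strategy: implemented by a finite-state machine reading the
visited vertices. -/
def FiniteMemoryF {V α : Type} (φ : List V → α) : Prop :=
  ∃ (M : Type) (_ : Finite M) (m0 : M) (up : M → V → M) (mov : M → V → α),
    ∀ (l : List V) (v : V), φ (l ++ [v]) = mov ((l ++ [v]).tail.foldl up m0) v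
/-- The nodes of the tree of finite prefixes of a set `P` of infinite words. -/
def PrefixesOf {X : Type} (P : Set (ℕ → X)) : Set (List X) :=
  {l | ∃ p ∈ P, BPrefix p l}

/-- `B` is nowhere dense in the tree whose set of branches is `P`:
below every node there is a node through which no branch of `B` passes. -/
def NowhereDenseIn {X : Type} (P B : Set (ℕ → X)) : Prop :=
  ∀ u ∈ PrefixesOf P, ∃ v ∈ PrefixesOf P, u <+: v ∧ ∀ b ∈ B, ¬ BPrefix b v

/-- `B` is meager in the tree whose set of branches is `P`:
a countable union of nowhere dense sets. -/
def MeagerIn {X : Type} (P B : Set (ℕ → X)) : Prop :=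
  ∃ f : ℕ → Set (ℕ → X), (∀ n, NowhereDenseIn P (f n)) ∧ B ⊆ ⋃ n, f n

/-- An Éloïse strategy is topologically-good if, against every Abélard strategy,
the set of plays she loses is meager in the tree of outcomes. -/
def TopGood {V : Type} (A : Arena V) (v0 : V) (Ω : Set (ℕ → V)) (φE : List V → V) : Prop :=
  ∀ φA, IsStrategyFor A Player.A φA →
    MeagerIn (Outcomes A v0 φE φA) (Outcomes A v0 φE φA \ Ω)
/-- `L ⊆ α^ω` is ω-regular: recognized by a nondeterministic Büchi automaton with
finitely many states. -/
def IsOmegaRegular {α : Type} (L : Set (ℕ → α)) : Prop :=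
  ∃ (Q : Type) (_ : Finite Q) (init : Set Q) (δ : Q → α → Set Q) (F : Set Q),
    L = {w | ∃ ρ : ℕ → Q, ρ 0 ∈ init ∧ (∀ n, ρ (n + 1) ∈ δ (ρ n) (w n)) ∧
      {n | ρ n ∈ F}.Infinite}

/-- `Ω` is an ω-regular winning condition: given by a map `τ : V → α` into a finite
alphabet and an ω-regular language `L ⊆ α^ω`. -/
def OmegaRegularWC {V : Type} (Ω : Set (ℕ → V)) : Prop :=
  ∃ (α : Type) (_ : Finite α) (τ : V → α) (L : Set (ℕ → α)),
    IsOmegaRegular L ∧ Ω = {p | (fun n => τ (p n)) ∈ L}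
/-! ### Determinization -/

/-- value of the segment `[m,n)` of the word `w` -/
def fseg {V S : Type} (one : S) (ext : S → V → S) (w : ℕ → V) (m : ℕ) : ℕ → S
  | 0 => one
  | n + 1 => open Classical in if m ≤ n then ext (fseg one ext w m n) (w n) else one

theorem fseg_succ {V S : Type} (one : S) (ext : S → V → S) (w : ℕ → V) {m n : ℕ} (h : m ≤ n) :
    fseg one ext w m (n + 1) = ext (fseg one ext w m n) (w n) := by
  simp [fseg, h]

theorem fseg_self {V S : Type} (one : S) (ext : S → V → S) (w : ℕ → V) (m : ℕ) :
    fseg one ext w m m = one := by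
  cases m with
  | zero => rfl
  | succ m => simp [fseg]

theorem fseg_merge {V S : Type} (one : S) (ext : S → V → S) (w : ℕ → V) {m n k : ℕ}
    (hm : m ≤ k) (hn : n ≤ k) (h : fseg one ext w m k = fseg one ext w n k) :
    ∀ k', k ≤ k' → fseg one ext w m k' = fseg one ext w n k' := by
  intro k' hk
  induction k', hk using Nat.le_induction with
  | base => exact h
  | succ i hi ih => rw [fseg_succ _ _ _ (by omega), fseg_succ _ _ _ (by omega), ih]

/-- Acceptance by a Büchi automaton. -/
def BAcc {V Q : Type} (init : Set Q) (δ : Q → V → Set Q) (F : Set Q) (w : ℕ → V) : Prop :=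
  ∃ ρ : ℕ → Q, ρ 0 ∈ init ∧ (∀ n, ρ (n + 1) ∈ δ (ρ n) (w n)) ∧ {n | ρ n ∈ F}.Infinite

abbrev BS (Q : Type) := Set (Q × Q × Bool) × Bool

def bone (Q : Type) : BS Q := ({t | t.1 = t.2.1 ∧ t.2.2 = false}, false)

def bext {V Q : Type} (δ : Q → V → Set Q) (F : Set Q) (x : BS Q) (a : V) : BS Q :=
  ({t | ∃ r b, (t.1, r, b) ∈ x.1 ∧ t.2.1 ∈ δ r a ∧ (t.2.2 = true ↔ (b = true ∨ r ∈ F))}, true)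

theorem bext_ne {V Q : Type} (δ : Q → V → Set Q) (F : Set Q) (x : BS Q) (a : V) :
    bext δ F x a ≠ bone Q := by
  intro h
  have := congrArg Prod.snd h
  simp [bext, bone] at this

theorem seg_of_run {V Q : Type} (δ : Q → V → Set Q) (F : Set Q) (w : ℕ → V) (ρ : ℕ → Q)
    (hρ : ∀ n, ρ (n + 1) ∈ δ (ρ n) (w n)) (m n : ℕ) (h : m ≤ n) :
    ∃ b, (ρ m, ρ n, b) ∈ (fseg (bone Q) (bext δ F) w m n).1 ∧
      (b = true ↔ ∃ i, m ≤ i ∧ i < n ∧ ρ i ∈ F) := by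
  classical
  induction n, h using Nat.le_induction with
  | base =>
    refine ⟨false, ?_, ?_⟩
    · rw [fseg_self]; simp [bone]
    · simp only [Bool.false_eq_true, false_iff]
      rintro ⟨i, h1, h2, _⟩; omega
  | succ n hn ih =>
    obtain ⟨b, hb, hb'⟩ := ih
    refine ⟨decide (b = true ∨ ρ n ∈ F), ?_, ?_⟩
    · rw [fseg_succ _ _ _ hn]
      exact ⟨ρ n, b, hb, hρ n, by simp⟩
    · simp only [decide_eq_true_eq]
      rw [hb']
      constructor
      · rintro (⟨i, h1, h2, h3⟩ | h)
        · exact ⟨i, h1, by omega, h3⟩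
        · exact ⟨n, hn, by omega, h⟩
      · rintro ⟨i, h1, h2, h3⟩
        rcases Nat.lt_succ_iff_lt_or_eq.mp h2 with h | rfl
        · exact Or.inl ⟨i, h1, h, h3⟩
        · exact Or.inr h3

theorem run_of_seg {V Q : Type} (δ : Q → V → Set Q) (F : Set Q) (w : ℕ → V)
    (m n : ℕ) (h : m ≤ n) : ∀ (q r : Q) (b : Bool),
    (q, r, b) ∈ (fseg (bone Q) (bext δ F) w m n).1 →
    ∃ ρ : ℕ → Q, ρ m = q ∧ ρ n = r ∧ (∀ i, m ≤ i → i < n → ρ (i + 1) ∈ δ (ρ i) (w i)) ∧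
      (b = true → ∃ i, m ≤ i ∧ i < n ∧ ρ i ∈ F) := by
  classical
  induction n, h using Nat.le_induction with
  | base =>
    intro q r b hb
    rw [fseg_self] at hb
    obtain ⟨h1, h2⟩ := hb
    simp only at h1 h2
    refine ⟨fun _ => q, rfl, h1, fun i _ _ => by omega, fun h => by simp [h2] at h⟩
  | succ n hn ih =>
    intro q r b hb
    rw [fseg_succ _ _ _ hn] at hb
    obtain ⟨r', b', h1, h2, h3⟩ := hb
    simp only at h1 h2 h3
    obtain ⟨ρ, e1, e2, e3, e4⟩ := ih q r' b' h1
    refine ⟨fun i => if i = n + 1 then r else ρ i, ?_, by simp, ?_, ?_⟩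
    · simp only; rw [if_neg (by omega)]; exact e1
    · intro i hi hi'
      simp only
      rw [if_neg (by omega : ¬ i = n + 1)]
      by_cases hin : i = n
      · subst hin; simp [e2, h2]
      · rw [if_neg (by omega)]; exact e3 i hi (by omega)
    · intro hb
      rcases h3.mp hb with h | h
      · obtain ⟨i, a1, a2, a3⟩ := e4 h
        refine ⟨i, a1, by omega, ?_⟩
        simp only; rw [if_neg (by omega)]; exact a3
      · refine ⟨n, hn, by omega, ?_⟩
        simp only; rw [if_neg (by omega), e2]; exact h

theorem bsat {V Q : Type} (init : Set Q) (δ : Q → V → Set Q) (F : Set Q) (w w' : ℕ → V)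
    (C C' : ℕ → ℕ) (hC : StrictMono C) (hC' : StrictMono C') (h0 : C 0 = 0) (h0' : C' 0 = 0)
    (hs : ∀ i, fseg (bone Q) (bext δ F) w (C i) (C (i + 1)) =
      fseg (bone Q) (bext δ F) w' (C' i) (C' (i + 1)))
    (hw : BAcc init δ F w) : BAcc init δ F w' := by
  classical
  obtain ⟨ρ, hi, hρ, hF⟩ := hw
  have h1 := fun i => seg_of_run δ F w ρ hρ (C i) (C (i + 1)) (hC (Nat.lt_succ_self i)).le
  choose b hb hbF using h1
  have h2 := fun i => run_of_seg δ F w' (C' i) (C' (i + 1)) (hC' (Nat.lt_succ_self i)).le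
    (ρ (C i)) (ρ (C (i + 1))) (b i) (by rw [← hs]; exact hb i)
  choose σ s1 s2 s3 s4 using h2
  have hex : ∀ n, ∃ i, n < C' (i + 1) := fun n => ⟨n, lt_of_lt_of_le (Nat.lt_succ_self n) (hC'.id_le (n + 1))⟩
  have key : ∀ n, ∃ i, C' i ≤ n ∧ n < C' (i + 1) := by
    intro n
    refine ⟨Nat.find (hex n), ?_, Nat.find_spec (hex n)⟩
    rcases hj : Nat.find (hex n) with _ | j
    · omega
    · have := Nat.find_min (hex n) (m := j) (by omega)
      omega
  choose idx i1 i2 using key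
  have huniq : ∀ n i, C' i ≤ n → n < C' (i + 1) → idx n = i := by
    intro n i a1 a2
    rcases lt_trichotomy (idx n) i with h | h | h
    · have := hC'.monotone (show idx n + 1 ≤ i from h); have := i2 n; omega
    · exact h
    · have := hC'.monotone (show i + 1 ≤ idx n from h); have := i1 n; omega
  have hval : ∀ n i, C' i ≤ n → n ≤ C' (i + 1) → σ (idx n) n = σ i n := by
    intro n i a1 a2
    rcases a2.lt_or_eq with a2 | a2
    · rw [huniq n i a1 a2]
    · have : idx n = i + 1 := huniq n (i + 1) a2.ge (by rw [a2]; exact hC' (Nat.lt_succ_self _))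
      rw [this, a2, s1, s2]
  refine ⟨fun n => σ (idx n) n, ?_, ?_, ?_⟩
  · have : idx 0 = 0 := huniq 0 0 (by omega) (by have := hC' (show 0 < 0 + 1 by omega); omega)
    simp only [this]
    have := s1 0
    rw [h0', h0] at this
    rw [this]; exact hi
  · intro n
    simp only
    rw [hval (n + 1) (idx n) (by have := i1 n; omega) (i2 n)]
    exact s3 _ _ (i1 n) (i2 n)
  · rw [Set.infinite_iff_exists_gt]
    intro N
    rw [Set.infinite_iff_exists_gt] at hF
    obtain ⟨n, hn, hnN⟩ := hF (C (N + 1))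
    have hexC : ∃ i, n < C (i + 1) := ⟨n, lt_of_lt_of_le (Nat.lt_succ_self n) (hC.id_le (n + 1))⟩
    set j := Nat.find hexC with hj
    have j2 : n < C (j + 1) := Nat.find_spec hexC
    have hjN : N < j := by
      by_contra hlt
      have := hC.monotone (show j + 1 ≤ N + 1 by omega); omega
    have j1 : C j ≤ n := by
      have := Nat.find_min hexC (m := j - 1) (by omega)
      rw [show j - 1 + 1 = j by omega] at this
      omega
    obtain ⟨i, a1, a2, a3⟩ := s4 j ((hbF j).mpr ⟨n, j1, j2, hn⟩)
    refine ⟨i, ?_, ?_⟩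
    · show σ (idx i) i ∈ F; rw [hval i j a1 a2.le]; exact a3
    · have := hC'.id_le j; simp only [id] at this; omega
/-! ### Merging analysis -/

/-- `m` is the least position with its value at time `k`. -/
def RepP {V S : Type} (one : S) (ext : S → V → S) (w : ℕ → V) (k m : ℕ) : Prop :=
  m ≤ k ∧ ∀ m' < m, fseg one ext w m' k ≠ fseg one ext w m k

/-- at step `k`, position `n` gets merged into `m`. -/
def Mrg {V S : Type} (one : S) (ext : S → V → S) (w : ℕ → V) (k m n : ℕ) : Prop :=
  m < n ∧ RepP one ext w k n ∧ RepP one ext w (k + 1) m ∧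
    fseg one ext w m (k + 1) = fseg one ext w n (k + 1)

/-- index of `m` after step `k` -/
noncomputable def Ix {V S : Type} (one : S) (ext : S → V → S) (w : ℕ → V) (k m : ℕ) : ℕ :=
  {m' | m' < m ∧ RepP one ext w (k + 1) m'}.ncard

/-- `p` is the least value occurring infinitely often. -/
def LimInf (s : ℕ → ℕ) (p : ℕ) : Prop :=
  (∀ N, ∃ k ≥ N, s k = p) ∧ ∃ N, ∀ k ≥ N, p ≤ s k

section merging
variable {V S : Type} {one : S} {ext : S → V → S} {w : ℕ → V}

theorem RepP.down {k m : ℕ} (h : RepP one ext w (k + 1) m) (hm : m ≤ k) : RepP one ext w k m := by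
  refine ⟨hm, fun m' hm' he => h.2 m' hm' ?_⟩
  exact fseg_merge one ext w (by omega) hm he (k + 1) (by omega)

theorem RepP.downs {k k' m : ℕ} (hk : k ≤ k') (h : RepP one ext w k' m) (hm : m ≤ k) :
    RepP one ext w k m := by
  induction k', hk using Nat.le_induction with
  | base => exact h
  | succ i hi ih => exact ih (h.down (by omega))

theorem rep_new (hne : ∀ x a, ext x a ≠ one) (k : ℕ) : RepP one ext w k k := by
  refine ⟨le_rfl, fun m' hm' he => ?_⟩
  rw [fseg_self] at he
  obtain ⟨j, rfl⟩ : ∃ j, k = j + 1 := ⟨k - 1, by omega⟩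
  rw [fseg_succ _ _ _ (by omega)] at he
  exact hne _ _ he

/-- the representative of a position -/
theorem exists_rep (k n : ℕ) (hn : n ≤ k) :
    ∃ m ≤ n, RepP one ext w k m ∧ fseg one ext w m k = fseg one ext w n k := by
  classical
  have hex : ∃ m, m ≤ n ∧ fseg one ext w m k = fseg one ext w n k := ⟨n, le_rfl, rfl⟩
  obtain ⟨h1, h2⟩ := Nat.find_spec hex
  refine ⟨Nat.find hex, h1, ⟨by omega, fun m' hm' he => ?_⟩, h2⟩
  exact Nat.find_min hex hm' ⟨by omega, he.trans h2⟩

theorem mrg_of_not_rep {k n : ℕ} (h : RepP one ext w k n) (h' : ¬ RepP one ext w (k + 1) n) :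
    ∃ m, Mrg one ext w k m n := by
  obtain ⟨m, hm, hr, he⟩ := exists_rep (one := one) (ext := ext) (w := w) (k + 1) n (by have := h.1; omega)
  refine ⟨m, lt_of_le_of_ne hm ?_, h, hr, he⟩
  rintro rfl; exact h' hr

theorem Mrg.not_rep {k m n : ℕ} (h : Mrg one ext w k m n) : ¬ RepP one ext w (k + 1) n :=
  fun hr => hr.2 m h.1 h.2.2.2

theorem rep_inj {k m n : ℕ} (hm : RepP one ext w k m) (hn : RepP one ext w k n)
    (h : fseg one ext w m k = fseg one ext w n k) : m = n := by
  rcases lt_trichotomy m n with h1 | h1 | h1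
  · exact absurd h (hn.2 m h1)
  · exact h1
  · exact absurd h.symm (hm.2 n h1)

theorem rep_fin (k m : ℕ) : {m' | m' < m ∧ RepP one ext w (k + 1) m'}.Finite :=
  (Set.finite_lt_nat m).subset fun _ h => h.1

theorem Ix_le [Finite S] (k m : ℕ) : Ix one ext w k m ≤ Nat.card S := by
  rw [← Set.ncard_univ]
  refine Set.ncard_le_ncard_of_injOn (fun m' => fseg one ext w m' (k + 1)) (fun _ _ => Set.mem_univ _) ?_
    Set.finite_univ
  intro a ha b hb hab
  exact rep_inj ha.2 hb.2 hab

theorem Ix_lt {k m n : ℕ} (hm : RepP one ext w (k + 1) m) (h : m < n) :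
    Ix one ext w k m < Ix one ext w k n := by
  refine Set.ncard_lt_ncard ?_ (rep_fin k n)
  refine ⟨fun a ha => ⟨ha.1.trans h, ha.2⟩, fun hsub => ?_⟩
  exact lt_irrefl m (hsub (show m ∈ _ from ⟨h, hm⟩)).1

theorem exists_mrg [Finite S] (hne : ∀ x a, ext x a ≠ one) (K : ℕ) :
    ∃ k ≥ K, ∃ m n, Mrg one ext w k m n := by
  by_contra hcon
  push Not at hcon
  have hp : ∀ k n, K ≤ n → n ≤ k → RepP one ext w k n := by
    intro k n hK hn
    induction k, hn using Nat.le_induction with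
    | base => exact rep_new hne n
    | succ k hk ih =>
      by_contra h
      obtain ⟨m, hm⟩ := mrg_of_not_rep ih h
      exact hcon k (by omega) m n hm
  set k := K + Nat.card S with hk
  have : Function.Injective (fun i : Fin (Nat.card S + 1) => fseg one ext w (K + i) k) := by
    intro i j hij
    have := rep_inj (hp k (K + i) (by omega) (by omega)) (hp k (K + j) (by omega) (by omega)) hij
    exact Fin.ext (by omega)
  have := Nat.card_le_card_of_injective _ this
  simp at this

theorem freq_pigeon {ι : Type} [Finite ι] (R : ℕ → ι → Prop) (h : ∀ N, ∃ k ≥ N, ∃ i, R k i) :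
    ∃ i, ∀ N, ∃ k ≥ N, R k i := by
  by_contra hcon
  push Not at hcon
  choose N hN using hcon
  have := Fintype.ofFinite ι
  obtain ⟨k, hk, i, hi⟩ := h (∑ i, N i)
  exact hN i k (le_trans (Finset.single_le_sum (f := N) (fun _ _ => Nat.zero_le _) (Finset.mem_univ i)) hk) hi

/-- There is an index flashing infinitely often with a persistent position. -/
theorem exists_persistent [Finite S] (hne : ∀ x a, ext x a ≠ one) :
    ∃ j m K, j ≤ Nat.card S ∧ (∀ N, ∃ k ≥ N, ∃ n, Mrg one ext w k m n) ∧
      (∀ k ≥ K, Ix one ext w k m = j) ∧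
      (∀ k ≥ K, ∀ m' n', Mrg one ext w k m' n' → Ix one ext w k m' = j → m' = m) ∧
      (∀ k ≥ K, ∀ m' n', Mrg one ext w k m' n' → j ≤ Ix one ext w k m') := by
  classical
  have hex : ∃ j, ∀ N, ∃ k ≥ N, ∃ m n, Mrg one ext w k m n ∧ Ix one ext w k m = j := by
    obtain ⟨i, hi⟩ := freq_pigeon (ι := Fin (Nat.card S + 1))
      (fun k i => ∃ m n, Mrg one ext w k m n ∧ Ix one ext w k m = i) (by
        intro N
        obtain ⟨k, hk, m, n, h⟩ := exists_mrg (w := w) hne N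
        exact ⟨k, hk, ⟨Ix one ext w k m, Nat.lt_succ_of_le (Ix_le k m)⟩, m, n, h, rfl⟩)
    exact ⟨i, hi⟩
  set j := Nat.find hex with hj
  have hj1 := Nat.find_spec hex
  rw [← hj] at hj1
  have hK : ∃ K, ∀ k ≥ K, ∀ m n, Mrg one ext w k m n → j ≤ Ix one ext w k m := by
    by_contra hcon
    push Not at hcon
    obtain ⟨i, hi⟩ := freq_pigeon (ι := Fin j)
      (fun k i => ∃ m n, Mrg one ext w k m n ∧ Ix one ext w k m = i) (by
        intro N
        obtain ⟨k, hk, m, n, h, hlt⟩ := hcon N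
        exact ⟨k, hk, ⟨_, hlt⟩, m, n, h, rfl⟩)
    exact Nat.find_min hex i.2 hi
  obtain ⟨K, hK⟩ := hK
  obtain ⟨k0, hk0, m, n0, hm0, hI0⟩ := hj1 K
  have hpers : ∀ k, k0 ≤ k → RepP one ext w (k + 1) m ∧ Ix one ext w k m = j := by
    intro k hk
    induction k, hk using Nat.le_induction with
    | base => exact ⟨hm0.2.2.1, hI0⟩
    | succ k hk ih =>
      obtain ⟨hr, hI⟩ := ih
      -- nothing at position ≤ m dies
      have hnd : ∀ m' ≤ m, RepP one ext w (k + 1) m' → RepP one ext w (k + 1 + 1) m' := by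
        intro m' hm' hr'
        by_contra hd
        obtain ⟨m2, hm2⟩ := mrg_of_not_rep hr' hd
        have h1 := hK (k + 1) (by omega) m2 m' hm2
        have h2 : Ix one ext w (k + 1) m2 < j := by
          rw [← hI]
          refine Set.ncard_lt_ncard ?_ (rep_fin k m)
          have hlt := hm2.1
          have hle := hr.1
          refine ⟨fun a ha => ⟨by have := ha.1; omega, ha.2.down (by have := ha.1; omega)⟩, fun hsub => ?_⟩
          exact lt_irrefl m2 (hsub (show m2 ∈ _ from ⟨by omega, hm2.2.2.1.down (by omega)⟩)).1
        omega
      refine ⟨hnd m le_rfl hr, ?_⟩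
      rw [← hI]
      unfold Ix
      congr 1
      ext a
      have hle := hr.1
      constructor
      · intro ha; exact ⟨ha.1, ha.2.down (by have := ha.1; omega)⟩
      · intro ha; exact ⟨ha.1, hnd a ha.1.le ha.2⟩
  have hun : ∀ k ≥ k0, ∀ m' n', Mrg one ext w k m' n' → Ix one ext w k m' = j → m' = m := by
    intro k hk m' n' hm' hI'
    obtain ⟨a, b⟩ := hpers k hk
    rcases lt_trichotomy m' m with h | h | h
    · have := Ix_lt hm'.2.2.1 h; omega
    · exact h
    · have := Ix_lt a h; omega
  refine ⟨j, m, k0, hI0 ▸ Ix_le _ _, ?_, fun k hk => (hpers k hk).2, hun, fun k hk => hK k (by omega)⟩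
  intro N
  obtain ⟨k, hk, m', n', h1, h2⟩ := hj1 (max N k0)
  have := hun k (le_trans (le_max_right _ _) hk) m' n' h1 h2
  subst this
  exact ⟨k, le_trans (le_max_left _ _) hk, n', h1⟩

theorem exists_fact (m : ℕ) (s e : S)
    (h : ∀ N, ∃ k ≥ N, ∃ n, Mrg one ext w k m n ∧ fseg one ext w 0 n = s ∧ fseg one ext w m n = e) :
    ∃ C : ℕ → ℕ, StrictMono C ∧ C 0 = 0 ∧ fseg one ext w 0 (C 1) = s ∧
      ∀ i, fseg one ext w (C (i + 1)) (C (i + 2)) = e := by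
  have h2 : ∀ N, ∃ k n, N < n ∧ Mrg one ext w k m n ∧ fseg one ext w 0 n = s ∧
      fseg one ext w m n = e := by
    by_contra hcon
    push Not at hcon
    obtain ⟨N, hN⟩ := hcon
    obtain ⟨i, hi⟩ := freq_pigeon (ι := Fin (N + 1)) (fun k i => Mrg one ext w k m i) (by
      intro M
      obtain ⟨k, hk, n, h1, h2, h3⟩ := h M
      have : n ≤ N := by
        by_contra hh
        exact hN k n (by omega) h1 h2 h3
      exact ⟨k, hk, ⟨n, by omega⟩, h1⟩)
    obtain ⟨k, _, h1⟩ := hi 0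
    obtain ⟨k', hk', h2⟩ := hi (k + 1)
    exact h1.not_rep (h2.2.1.downs hk' (by have := h1.2.1.1; omega))
  choose kk nn g1 g2 g3 g4 using h2
  let D : ℕ → ℕ := fun i => Nat.rec 0 (fun _ N => kk N) i
  have hD : ∀ i, D (i + 1) = kk (D i) := fun i => rfl
  have hkn : ∀ N, nn N ≤ kk N := fun N => (g2 N).2.1.1
  let C : ℕ → ℕ := fun i => match i with
    | 0 => 0
    | i + 1 => nn (D i)
  refine ⟨C, strictMono_nat_of_lt_succ ?_, rfl, g3 _, ?_⟩
  · intro i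
    cases i with
    | zero => exact lt_of_le_of_lt (Nat.zero_le _) (g1 _)
    | succ i =>
      show nn (D i) < nn (D (i + 1))
      have := g1 (D (i + 1)); have h2 := hkn (D i); rw [hD] at this ⊢; omega
  · intro i
    show fseg one ext w (nn (D i)) (nn (D (i + 1))) = e
    rw [← g4 (D (i + 1)), hD]
    have hM := g2 (D i)
    have h1 := g1 (kk (D i))
    refine (fseg_merge one ext w (k := kk (D i) + 1) ?_ ?_ hM.2.2.2 _ h1).symm
    · exact hM.2.2.1.1
    · have := hM.2.1.1; omega

end merging

/-! ### The deterministic parity automaton -/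

/-- semantic state -/
def stT {V S : Type} (one : S) (ext : S → V → S) (w : ℕ → V) (k : ℕ) : Set (S × S × S × S) :=
  {t | ∃ m n, m ≤ n ∧ RepP one ext w k m ∧ RepP one ext w k n ∧
    t = (fseg one ext w m k, fseg one ext w n k, fseg one ext w 0 n, fseg one ext w m n)}

def older {S : Type} (T : Set (S × S × S × S)) (x y : S) : Prop := x ≠ y ∧ ∃ s e, (x, y, s, e) ∈ T

def surv {V S : Type} (ext : S → V → S) (T : Set (S × S × S × S)) (a : V) (x : S) : Prop :=
  (∃ s e, (x, x, s, e) ∈ T) ∧ ∀ x', older T x' x → ext x' a ≠ ext x a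

def updT {V S : Type} (one : S) (ext : S → V → S) (p : S × Set (S × S × S × S)) (a : V) :
    S × Set (S × S × S × S) :=
  (ext p.1 a,
   {t | (∃ x y s e, (x, y, s, e) ∈ p.2 ∧ surv ext p.2 a x ∧ surv ext p.2 a y ∧
          t = (ext x a, ext y a, s, e)) ∨
        (∃ x, surv ext p.2 a x ∧ t = (ext x a, one, ext p.1 a, ext x a)) ∨
        t = (one, one, ext p.1 a, one)})

def flash {V S : Type} (ext : S → V → S) (T : Set (S × S × S × S)) (a : V) (x y s e : S) : Prop :=
  (x, y, s, e) ∈ T ∧ x ≠ y ∧ surv ext T a x ∧ ext x a = ext y a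

noncomputable def idxT {V S : Type} (ext : S → V → S) (T : Set (S × S × S × S)) (a : V) (x : S) : ℕ :=
  {x' | older T x' x ∧ surv ext T a x'}.ncard

noncomputable def prioT {V S : Type} (ext : S → V → S) (Good : S → S → Prop)
    (T : Set (S × S × S × S)) (a : V) : ℕ :=
  sInf ({c | (∃ x y s e, flash ext T a x y s e ∧ Good s e ∧ c = 2 * idxT ext T a x) ∨
    (∃ x y s e, flash ext T a x y s e ∧ ¬ Good s e ∧ c = 2 * idxT ext T a x + 1) ∨
    c = 2 * Nat.card S + 2})

section dpa
variable {V S : Type} {one : S} {ext : S → V → S} {w : ℕ → V}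

theorem mem_stT {k m n : ℕ} (hm : RepP one ext w k m) (hn : RepP one ext w k n) (s e : S) :
    (fseg one ext w m k, fseg one ext w n k, s, e) ∈ stT one ext w k ↔
      m ≤ n ∧ s = fseg one ext w 0 n ∧ e = fseg one ext w m n := by
  constructor
  · rintro ⟨m', n', h, h1, h2, heq⟩
    simp only [Prod.mk.injEq] at heq
    obtain ⟨e1, e2, e3, e4⟩ := heq
    obtain rfl := rep_inj hm h1 e1
    obtain rfl := rep_inj hn h2 e2
    exact ⟨h, e3, e4⟩
  · rintro ⟨h, rfl, rfl⟩
    exact ⟨m, n, h, hm, hn, rfl⟩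

theorem older_stT {k m n : ℕ} (hm : RepP one ext w k m) (hn : RepP one ext w k n) :
    older (stT one ext w k) (fseg one ext w m k) (fseg one ext w n k) ↔ m < n := by
  unfold older
  simp only [mem_stT hm hn]
  constructor
  · rintro ⟨h1, s, e, h2, _⟩
    exact lt_of_le_of_ne h2 (fun h => h1 (by rw [h]))
  · intro h
    exact ⟨hn.2 m h, _, _, h.le, rfl, rfl⟩

theorem older_left {k : ℕ} {x y : S} (h : older (stT one ext w k) x y) :
    ∃ m, RepP one ext w k m ∧ x = fseg one ext w m k := by
  obtain ⟨_, s, e, m, n, _, h1, h2, heq⟩ := h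
  simp only [Prod.mk.injEq] at heq
  exact ⟨m, h1, heq.1⟩

theorem surv_stT {k m : ℕ} (hm : RepP one ext w k m) :
    surv ext (stT one ext w k) (w k) (fseg one ext w m k) ↔ RepP one ext w (k + 1) m := by
  constructor
  · rintro ⟨_, h⟩
    by_contra hd
    obtain ⟨m', hM⟩ := mrg_of_not_rep hm hd
    have hr : RepP one ext w k m' := hM.2.2.1.down (by have := hM.1; have := hm.1; omega)
    refine h _ ((older_stT hr hm).mpr hM.1) ?_
    rw [← fseg_succ one ext w hr.1, ← fseg_succ one ext w hm.1]
    exact hM.2.2.2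
  · intro hr
    refine ⟨⟨_, _, (mem_stT hm hm _ _).mpr ⟨le_rfl, rfl, rfl⟩⟩, ?_⟩
    intro x' hx' he
    obtain ⟨m', hm', rfl⟩ := older_left hx'
    rw [older_stT hm' hm] at hx'
    rw [← fseg_succ one ext w hm'.1, ← fseg_succ one ext w hm.1] at he
    exact hr.2 m' hx' he

theorem surv_left {k : ℕ} {x : S} (h : surv ext (stT one ext w k) (w k) x) :
    ∃ m, RepP one ext w k m ∧ x = fseg one ext w m k := by
  obtain ⟨⟨s, e, m, n, _, h1, h2, heq⟩, _⟩ := h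
  simp only [Prod.mk.injEq] at heq
  exact ⟨m, h1, heq.1⟩

theorem updT_stT (hne : ∀ x a, ext x a ≠ one) (k : ℕ) :
    updT one ext (fseg one ext w 0 k, stT one ext w k) (w k) =
      (fseg one ext w 0 (k + 1), stT one ext w (k + 1)) := by
  unfold updT
  rw [fseg_succ _ _ _ (Nat.zero_le k)]
  congr 1
  ext t
  constructor
  · rintro (⟨x, y, s, e, h1, h2, h3, rfl⟩ | ⟨x, h, rfl⟩ | rfl)
    · obtain ⟨m, hm, rfl⟩ := surv_left h2
      obtain ⟨n, hn, rfl⟩ := surv_left h3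
      simp only at h1 h2 h3
      rw [mem_stT hm hn] at h1
      rw [surv_stT hm] at h2
      rw [surv_stT hn] at h3
      refine ⟨m, n, h1.1, h2, h3, ?_⟩
      rw [fseg_succ _ _ _ hm.1, fseg_succ _ _ _ hn.1, h1.2.1, h1.2.2]
    · obtain ⟨m, hm, rfl⟩ := surv_left h
      simp only at h
      rw [surv_stT hm] at h
      refine ⟨m, k + 1, by have := hm.1; omega, h, rep_new hne _, ?_⟩
      rw [fseg_self, fseg_succ _ _ _ hm.1, fseg_succ _ _ _ (Nat.zero_le k)]
    · refine ⟨k + 1, k + 1, le_rfl, rep_new hne _, rep_new hne _, ?_⟩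
      rw [fseg_self, fseg_succ _ _ _ (Nat.zero_le k)]
  · rintro ⟨m, n, hmn, hm, hn, rfl⟩
    rcases Nat.lt_or_ge n (k + 1) with hnk | hnk
    · left
      have hn' := hn.down (by omega)
      have hm' := hm.down (by omega)
      refine ⟨_, _, _, _, (mem_stT hm' hn' _ _).mpr ⟨hmn, rfl, rfl⟩, (surv_stT hm').mpr hm,
        (surv_stT hn').mpr hn, ?_⟩
      rw [fseg_succ _ _ _ hm'.1, fseg_succ _ _ _ hn'.1]
    · have hnk : n = k + 1 := le_antisymm hn.1 hnk
      subst hnk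
      rcases Nat.lt_or_ge m (k + 1) with hmk | hmk
      · right; left
        have hm' := hm.down (by omega)
        refine ⟨_, (surv_stT hm').mpr hm, ?_⟩
        rw [fseg_self, fseg_succ _ _ _ hm'.1, fseg_succ _ _ _ (Nat.zero_le k)]
      · right; right
        have hmk : m = k + 1 := le_antisymm hm.1 hmk
        subst hmk
        rw [fseg_self, fseg_succ _ _ _ (Nat.zero_le k)]

theorem idxT_stT {k m : ℕ} (hm : RepP one ext w k m) :
    idxT ext (stT one ext w k) (w k) (fseg one ext w m k) = Ix one ext w k m := by
  unfold idxT Ix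
  rw [← Set.InjOn.ncard_image (f := fun m' => fseg one ext w m' k) (s := {m' | m' < m ∧ RepP one ext w (k + 1) m'})]
  · congr 1
    ext x
    constructor
    · rintro ⟨h1, h2⟩
      obtain ⟨m', hm', rfl⟩ := older_left h1
      exact ⟨m', ⟨(older_stT hm' hm).mp h1, (surv_stT hm').mp h2⟩, rfl⟩
    · rintro ⟨m', ⟨h1, h2⟩, rfl⟩
      have hm' : RepP one ext w k m' := h2.down (by have := hm.1; omega)
      exact ⟨(older_stT hm' hm).mpr h1, (surv_stT hm').mpr h2⟩
  · intro a ha b hb hab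
    exact rep_inj (ha.2.down (by have := hm.1; have := ha.1; omega))
      (hb.2.down (by have := hm.1; have := hb.1; omega)) hab

theorem flash_stT {k : ℕ} {x y s e : S} :
    flash ext (stT one ext w k) (w k) x y s e ↔
      ∃ m n, Mrg one ext w k m n ∧ RepP one ext w k m ∧ x = fseg one ext w m k ∧
        y = fseg one ext w n k ∧ s = fseg one ext w 0 n ∧ e = fseg one ext w m n := by
  constructor
  · rintro ⟨⟨m, n, hmn, hm, hn, heq⟩, hne, hs, he⟩
    simp only [Prod.mk.injEq] at heq
    obtain ⟨rfl, rfl, rfl, rfl⟩ := heq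
    rw [surv_stT hm] at hs
    rw [← fseg_succ one ext w hm.1, ← fseg_succ one ext w hn.1] at he
    exact ⟨m, n, ⟨lt_of_le_of_ne hmn (fun h => hne (by rw [h])), hn, hs, he⟩, hm, rfl, rfl, rfl, rfl⟩
  · rintro ⟨m, n, hM, hm, rfl, rfl, rfl, rfl⟩
    have hn := hM.2.1
    refine ⟨(mem_stT hm hn _ _).mpr ⟨hM.1.le, rfl, rfl⟩, hn.2 m hM.1, (surv_stT hm).mpr hM.2.2.1, ?_⟩
    rw [← fseg_succ one ext w hm.1, ← fseg_succ one ext w hn.1]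
    exact hM.2.2.2

theorem prio_spec [Finite S] (hne : ∀ x a, ext x a ≠ one) (Good : S → S → Prop) (inL : Prop)
    (hG : ∀ C : ℕ → ℕ, StrictMono C → C 0 = 0 →
      ∀ s e, fseg one ext w 0 (C 1) = s → (∀ i, fseg one ext w (C (i + 1)) (C (i + 2)) = e) →
      (inL ↔ Good s e)) :
    ∃ p, LimInf (fun k => prioT ext Good (stT one ext w k) (w k)) p ∧ (inL ↔ Even p) := by
  classical
  obtain ⟨j, m, K, hj, hinf, hIx, hun, hmin⟩ := exists_persistent (w := w) hne
  -- eventually all merges into `m` are consistent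
  have hcons : ∃ K', ∀ k ≥ K', ∀ n, Mrg one ext w k m n →
      (inL ↔ Good (fseg one ext w 0 n) (fseg one ext w m n)) := by
    by_contra hcon
    push Not at hcon
    obtain ⟨⟨s, e⟩, hse⟩ := freq_pigeon (ι := S × S) (fun k se => ∃ n, Mrg one ext w k m n ∧
        (fseg one ext w 0 n = se.1 ∧ fseg one ext w m n = se.2) ∧ ¬ (inL ↔ Good se.1 se.2)) (by
      intro N
      obtain ⟨k, hk, n, h1, h2⟩ := hcon N
      exact ⟨k, hk, (_, _), n, h1, ⟨rfl, rfl⟩, by tauto⟩)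
    obtain ⟨_, _, _, _, _, hbad⟩ := hse 0
    obtain ⟨C, c1, c2, c3, c4⟩ := exists_fact (one := one) (ext := ext) (w := w) m s e (by
      intro N
      obtain ⟨k, hk, n, h1, h2, _⟩ := hse N
      exact ⟨k, hk, n, h1, h2⟩)
    exact hbad (hG C c1 c2 s e c3 c4)
  obtain ⟨K', hK'⟩ := hcons
  have hrep : ∀ k m n, Mrg one ext w k m n → RepP one ext w k m := fun k m n h =>
    h.2.2.1.down (by have := h.1; have := h.2.1.1; omega)
  by_cases hL : inL
  · refine ⟨2 * j, ⟨?_, ?_⟩, by simp [hL]⟩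
    · intro N
      obtain ⟨k, hk, n, hM⟩ := hinf (max N (max K K'))
      simp only [max_le_iff, ge_iff_le] at hk
      refine ⟨k, hk.1, le_antisymm (Nat.sInf_le ?_) (le_csInf ⟨_, Or.inr (Or.inr rfl)⟩ ?_)⟩
      · left
        refine ⟨_, _, _, _, flash_stT.mpr ⟨m, n, hM, hrep _ _ _ hM, rfl, rfl, rfl, rfl⟩,
          (hK' k hk.2.2 n hM).mp hL, ?_⟩
        rw [idxT_stT (hrep _ _ _ hM), hIx k hk.2.1]
      · rintro c (⟨x, y, s, e, hf, _, rfl⟩ | ⟨x, y, s, e, hf, _, rfl⟩ | rfl)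
        · obtain ⟨m', n', hM', hr, rfl, rfl, rfl, rfl⟩ := flash_stT.mp hf
          rw [idxT_stT hr]; have := hmin k hk.2.1 _ _ hM'; omega
        · obtain ⟨m', n', hM', hr, rfl, rfl, rfl, rfl⟩ := flash_stT.mp hf
          rw [idxT_stT hr]; have := hmin k hk.2.1 _ _ hM'; omega
        · omega
    · refine ⟨K, fun k hk => le_csInf ⟨_, Or.inr (Or.inr rfl)⟩ ?_⟩
      rintro c (⟨x, y, s, e, hf, _, rfl⟩ | ⟨x, y, s, e, hf, _, rfl⟩ | rfl)
      · obtain ⟨m', n', hM', hr, rfl, rfl, rfl, rfl⟩ := flash_stT.mp hf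
        rw [idxT_stT hr]; have := hmin k hk _ _ hM'; omega
      · obtain ⟨m', n', hM', hr, rfl, rfl, rfl, rfl⟩ := flash_stT.mp hf
        rw [idxT_stT hr]; have := hmin k hk _ _ hM'; omega
      · omega
  · have hlow : ∀ k ≥ max K K', 2 * j + 1 ≤ prioT ext Good (stT one ext w k) (w k) := by
      intro k hk
      simp only [max_le_iff, ge_iff_le] at hk
      refine le_csInf ⟨_, Or.inr (Or.inr rfl)⟩ ?_
      rintro c (⟨x, y, s, e, hf, hg, rfl⟩ | ⟨x, y, s, e, hf, _, rfl⟩ | rfl)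
      · obtain ⟨m', n', hM', hr, rfl, rfl, rfl, rfl⟩ := flash_stT.mp hf
        rw [idxT_stT hr]; have h1 := hmin k hk.1 _ _ hM'
        have : Ix one ext w k m' ≠ j := by
          intro h
          obtain rfl := hun k hk.1 _ _ hM' h
          exact hL ((hK' k hk.2 _ hM').mpr hg)
        omega
      · obtain ⟨m', n', hM', hr, rfl, rfl, rfl, rfl⟩ := flash_stT.mp hf
        rw [idxT_stT hr]; have := hmin k hk.1 _ _ hM'; omega
      · omega
    refine ⟨2 * j + 1, ⟨?_, ⟨_, hlow⟩⟩, by simp [hL]⟩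
    intro N
    obtain ⟨k, hk, n, hM⟩ := hinf (max N (max K K'))
    have hk' := hk
    simp only [max_le_iff, ge_iff_le] at hk
    refine ⟨k, hk.1, le_antisymm (Nat.sInf_le ?_) (hlow k (by simp only [max_le_iff, ge_iff_le]; exact hk.2))⟩
    right; left
    refine ⟨_, _, _, _, flash_stT.mpr ⟨m, n, hM, hrep _ _ _ hM, rfl, rfl, rfl, rfl⟩,
      fun hg => hL ((hK' k hk.2.2 n hM).mpr hg), ?_⟩
    rw [idxT_stT (hrep _ _ _ hM), hIx k hk.2.1]

end dpa

theorem exists_dpa {V : Type} [Finite V] (Ω : Set (ℕ → V)) (hΩ : OmegaRegularWC Ω) :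
    ∃ (Qs : Type) (_ : Finite Qs) (start : V → Qs) (up : Qs → V → Qs) (pr : Qs → ℕ),
      ∀ (w : ℕ → V) (r : ℕ → Qs), r 0 = start (w 0) → (∀ k, r (k + 1) = up (r k) (w (k + 1))) →
        ∃ p, LimInf (fun k => pr (r k)) p ∧ (w ∈ Ω ↔ Even p) := by
  obtain ⟨α, _, τ, L, ⟨Q, _, init, δ0, F, rfl⟩, rfl⟩ := hΩ
  let δ : Q → V → Set Q := fun q v => δ0 q (τ v)
  let one := bone Q
  let ext := bext δ F
  have hne : ∀ x a, ext x a ≠ one := bext_ne δ F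
  let Good : BS Q → BS Q → Prop := fun s e => ∃ (w : ℕ → V) (C : ℕ → ℕ), StrictMono C ∧ C 0 = 0 ∧
    fseg one ext w 0 (C 1) = s ∧ (∀ i, fseg one ext w (C (i + 1)) (C (i + 2)) = e) ∧ BAcc init δ F w
  refine ⟨(BS Q × Set (BS Q × BS Q × BS Q × BS Q)) × V, inferInstance,
    fun v => ((one, {(one, one, one, one)}), v), fun q v => (updT one ext q.1 q.2, v),
    fun q => prioT ext Good q.1.2 q.2, ?_⟩
  intro w r h0 hr
  have hst : ∀ k, r k = ((fseg one ext w 0 k, stT one ext w k), w k) := by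
    intro k
    induction k with
    | zero =>
      rw [h0]
      suffices h : ({(one, one, one, one)} : Set (BS Q × BS Q × BS Q × BS Q)) = stT one ext w 0 by
        simp only [h]; rfl
      refine Set.ext fun t => ?_
      constructor
      · rintro rfl
        exact ⟨0, 0, le_rfl, rep_new hne 0, rep_new hne 0, rfl⟩
      · rintro ⟨m, n, hmn, hm, hn, rfl⟩
        obtain rfl : n = 0 := Nat.le_zero.mp hn.1
        obtain rfl : m = 0 := Nat.le_zero.mp hm.1
        rfl
    | succ k ih =>
      rw [hr, ih]
      simp only
      rw [updT_stT hne]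
  obtain ⟨p, hp, hp'⟩ := prio_spec (one := one) (ext := ext) (w := w) hne Good (BAcc init δ F w) (by
    intro C c1 c2 s e hs he
    constructor
    · intro h
      exact ⟨w, C, c1, c2, hs, he, h⟩
    · rintro ⟨w', C', c1', c2', hs', he', h⟩
      refine bsat init δ F w' w C' C c1' c1 c2' c2 ?_ h
      intro i
      cases i with
      | zero => rw [c2, c2', zero_add]; exact hs'.trans hs.symm
      | succ i => exact (he' i).trans (he i).symm)
  refine ⟨p, ?_, ?_⟩
  · simpa only [hst] using hp
  · exact hp'
/-! ### Qualitative parity games with Nature: combinatorics -/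

def opp : Player → Player
  | Player.E => Player.A
  | Player.A => Player.E
  | Player.N => Player.N

theorem opp_opp (P : Player) : opp (opp P) = P := by cases P <;> rfl
theorem opp_ne_N {P : Player} (h : P ≠ Player.N) : opp P ≠ Player.N := by cases P <;> simp_all [opp]
theorem opp_ne {P : Player} (h : P ≠ Player.N) : opp P ≠ P := by cases P <;> simp_all [opp]
theorem player_cases {P : Player} (h : P ≠ Player.N) (Q : Player) :
    Q = P ∨ Q = opp P ∨ Q = Player.N := by cases P <;> cases Q <;> simp_all [opp]

def goodP (P : Player) (n : ℕ) : Prop :=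
  match P with
  | Player.E => Even n
  | _ => ¬ Even n

theorem goodP_opp {P : Player} (h : P ≠ Player.N) {n : ℕ} (hn : ¬ goodP P n) : goodP (opp P) n := by
  cases P
  · exact hn
  · simpa [goodP, opp] using hn
  · exact absurd rfl h

section games
variable {X : Type} (Ed : X → X → Prop) (ow : X → Player) (pr : X → ℕ)

def SubAr (U : Set X) : Prop :=
  ∀ x ∈ U, (∃ y ∈ U, Ed x y) ∧ (ow x = Player.N → ∀ y, Ed x y → y ∈ U)

def PStep (P : Player) (σ : X → X) (S : Set X) (a b : X) : Prop :=
  a ∈ S ∧ b ∈ S ∧ Ed a b ∧ (ow a = P → b = σ a)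

def EC (P : Player) (σ : X → X) (S : Set X) : Prop :=
  S.Nonempty ∧ (∀ x ∈ S, ow x = Player.N → ∀ y, Ed x y → y ∈ S) ∧
    (∀ x ∈ S, ∃ y, PStep Ed ow P σ S x y) ∧
    ∀ x ∈ S, ∀ y ∈ S, Relation.ReflTransGen (PStep Ed ow P σ S) x y

def goodS (P : Player) (S : Set X) : Prop :=
  ∃ x ∈ S, goodP P (pr x) ∧ ∀ y ∈ S, pr x ≤ pr y

def PWins (P : Player) (U : Set X) (σ : X → X) : Prop :=
  (∀ x ∈ U, ow x = P → Ed x (σ x) ∧ σ x ∈ U) ∧ ∀ S ⊆ U, EC Ed ow P σ S → goodS pr P S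

def AttrN (P : Player) (U D : Set X) : ℕ → Set X
  | 0 => D
  | n + 1 => AttrN P U D n ∪ {x | x ∈ U ∧ ((ow x ≠ opp P ∧ ∃ y ∈ AttrN P U D n, Ed x y) ∨
      (ow x = opp P ∧ ∀ y ∈ U, Ed x y → y ∈ AttrN P U D n))}

def Attr (P : Player) (U D : Set X) : Set X := {x | ∃ n, x ∈ AttrN Ed ow P U D n}

def WinTrap (P : Player) (U C : Set X) (σ : X → X) : Prop :=
  C ⊆ U ∧ C.Nonempty ∧ (∀ x ∈ C, ow x ≠ P → ∀ y ∈ U, Ed x y → y ∈ C) ∧ PWins Ed ow pr P C σ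

variable {Ed ow pr}

theorem EC.congr {P : Player} {σ τ : X → X} {S : Set X} (h : EC Ed ow P σ S)
    (hst : ∀ x ∈ S, ow x = P → σ x = τ x) : EC Ed ow P τ S := by
  have hs : ∀ a b, PStep Ed ow P σ S a b → PStep Ed ow P τ S a b := by
    rintro a b ⟨h1, h2, h3, h4⟩
    exact ⟨h1, h2, h3, fun ho => (h4 ho).trans (hst a h1 ho)⟩
  refine ⟨h.1, h.2.1, fun x hx => ?_, fun x hx y hy => Relation.ReflTransGen.mono hs _ _ (h.2.2.2 x hx y hy)⟩
  obtain ⟨y, hy⟩ := h.2.2.1 x hx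
  exact ⟨y, hs _ _ hy⟩

theorem AttrN_mono {P : Player} {U D : Set X} : Monotone (AttrN Ed ow P U D) :=
  monotone_nat_of_le_succ fun _ _ hx => Or.inl hx

theorem subset_Attr {P : Player} {U D : Set X} : D ⊆ Attr Ed ow P U D := fun _ hx => ⟨0, hx⟩

theorem attr_some {P : Player} {U D : Set X} {x y : X} (hx : x ∈ U) (ho : ow x ≠ opp P)
    (he : Ed x y) (hy : y ∈ Attr Ed ow P U D) : x ∈ Attr Ed ow P U D := by
  obtain ⟨n, hn⟩ := hy
  exact ⟨n + 1, Or.inr ⟨hx, Or.inl ⟨ho, y, hn, he⟩⟩⟩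

theorem attr_all [Finite X] {P : Player} {U D : Set X} {x : X} (hx : x ∈ U) (ho : ow x = opp P)
    (h : ∀ y ∈ U, Ed x y → y ∈ Attr Ed ow P U D) : x ∈ Attr Ed ow P U D := by
  have := Fintype.ofFinite X
  have h' : ∀ y, ∃ n, y ∈ U → Ed x y → y ∈ AttrN Ed ow P U D n := by
    intro y
    by_cases hy : y ∈ U ∧ Ed x y
    · obtain ⟨n, hn⟩ := h y hy.1 hy.2
      exact ⟨n, fun _ _ => hn⟩
    · exact ⟨0, fun a b => absurd ⟨a, b⟩ hy⟩
  choose n hn using h'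
  refine ⟨(∑ y, n y) + 1, Or.inr ⟨hx, Or.inr ⟨ho, fun y hy he => ?_⟩⟩⟩
  exact AttrN_mono (Finset.single_le_sum (f := n) (fun _ _ => Nat.zero_le _) (Finset.mem_univ y)) (hn y hy he)

theorem SubAr_compl [Finite X] {P : Player} (hP : P ≠ Player.N) {U D : Set X} (hU : SubAr Ed ow U) :
    SubAr Ed ow (U \ Attr Ed ow P U D) := by
  rintro x ⟨hx, hxA⟩
  obtain ⟨⟨y, hy, he⟩, hN⟩ := hU x hx
  constructor
  · by_cases ho : ow x = opp P
    · by_contra hcon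
      push Not at hcon
      exact hxA (attr_all hx ho fun y hy he => by
        by_contra hh
        exact hcon y ⟨hy, hh⟩ he)
    · exact ⟨y, ⟨hy, fun hA => hxA (attr_some hx ho he hA)⟩, he⟩
  · intro ho y he
    refine ⟨hN ho y he, fun hA => hxA (attr_some hx ?_ he hA)⟩
    rw [ho]; exact (opp_ne_N hP).symm

/-- attractor strategy -/
theorem attr_strat {P : Player} (hP : P ≠ Player.N) (U D : Set X) :
    ∃ σ : X → X, ∀ n x, x ∈ AttrN Ed ow P U D (n + 1) → x ∉ D → ow x = P →
      Ed x (σ x) ∧ σ x ∈ AttrN Ed ow P U D n := by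
  classical
  have key : ∀ x, ∃ y, ∀ n, x ∈ AttrN Ed ow P U D (n + 1) → x ∉ D → ow x = P →
      Ed x y ∧ y ∈ AttrN Ed ow P U D n := by
    intro x
    by_cases h : (∃ n, x ∈ AttrN Ed ow P U D (n + 1)) ∧ x ∉ D ∧ ow x = P
    · obtain ⟨hex, hD, ho⟩ := h
      have h1 := Nat.find_spec hex
      have h2 : x ∉ AttrN Ed ow P U D (Nat.find hex) := by
        intro hh
        rcases hk : Nat.find hex with _ | k
        · rw [hk] at hh; exact hD hh
        · rw [hk] at hh
          exact Nat.find_min hex (m := k) (by omega) hh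
      rcases h1 with h1 | ⟨_, ⟨_, y, hy, he⟩ | ⟨h3, _⟩⟩
      · exact absurd h1 h2
      · exact ⟨y, fun n hn _ _ => ⟨he, AttrN_mono (Nat.find_min' hex hn) hy⟩⟩
      · rw [ho] at h3; exact absurd h3.symm (opp_ne hP)
    · exact ⟨x, fun n a b c => absurd ⟨⟨n, a⟩, b, c⟩ h⟩
  choose σ hσ using key
  exact ⟨σ, fun n x => hσ x n⟩

theorem attr_sub {P : Player} {U D : Set X} (hD : D ⊆ U) : ∀ n, AttrN Ed ow P U D n ⊆ U := by
  intro n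
  induction n with
  | zero => exact hD
  | succ n ih => exact Set.union_subset ih fun x hx => hx.1

theorem trap_lift {P : Player} {U D C : Set X}
    (hC : C ⊆ U \ Attr Ed ow P U D)
    (h : ∀ x ∈ C, ow x ≠ opp P → ∀ y ∈ U \ Attr Ed ow P U D, Ed x y → y ∈ C) :
    ∀ x ∈ C, ow x ≠ opp P → ∀ y ∈ U, Ed x y → y ∈ C := by
  intro x hx ho y hy he
  exact h x hx ho y ⟨hy, fun hA => (hC hx).2 (attr_some (hC hx).1 ho he hA)⟩ he

theorem glue [Finite X] {P : Player} (hP : P ≠ Player.N) {U D : Set X} (hD : D ⊆ U)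
    (σD τ : X → X) (hσD : ∀ x ∈ D, ow x = P → Ed x (σD x) ∧ σD x ∈ U)
    (hgood : ∀ (σ : X → X) (S : Set X), S ⊆ U → (∀ x ∈ D, ow x = P → σ x = σD x) →
      EC Ed ow P σ S → (S ∩ D).Nonempty → goodS pr P S)
    (hτ : PWins Ed ow pr P (U \ Attr Ed ow P U D) τ) : ∃ σ, PWins Ed ow pr P U σ := by
  classical
  obtain ⟨σA, hσA⟩ := attr_strat (Ed := Ed) (ow := ow) hP U D
  let σ : X → X := fun x => if x ∈ D then σD x else if x ∈ Attr Ed ow P U D then σA x else τ x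
  have e1 : ∀ x ∈ D, σ x = σD x := fun x hx => by simp [σ, hx]
  have e2 : ∀ x ∉ D, x ∈ Attr Ed ow P U D → σ x = σA x := fun x hx hx' => by simp [σ, hx, hx']
  have e3 : ∀ x ∉ Attr Ed ow P U D, σ x = τ x := fun x hx => by
    have : x ∉ D := fun h => hx (subset_Attr h)
    simp [σ, hx, this]
  have hlow : ∀ n x, x ∈ AttrN Ed ow P U D n → x ∉ D → ow x = P → ∃ m, n = m + 1 ∧
      Ed x (σA x) ∧ σA x ∈ AttrN Ed ow P U D m := by
    intro n x hx hxD ho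
    cases n with
    | zero => exact absurd hx hxD
    | succ m => exact ⟨m, rfl, hσA m x hx hxD ho⟩
  refine ⟨σ, ?_, ?_⟩
  · intro x hx ho
    by_cases hxD : x ∈ D
    · rw [e1 x hxD]; exact hσD x hxD ho
    · by_cases hxA : x ∈ Attr Ed ow P U D
      · rw [e2 x hxD hxA]
        obtain ⟨n, hn⟩ := hxA
        obtain ⟨m, rfl, h1, h2⟩ := hlow n x hn hxD ho
        exact ⟨h1, attr_sub hD m h2⟩
      · rw [e3 x hxA]
        exact ⟨(hτ.1 x ⟨hx, hxA⟩ ho).1, (hτ.1 x ⟨hx, hxA⟩ ho).2.1⟩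
  · intro S hS hEC
    by_cases hmeet : (S ∩ Attr Ed ow P U D).Nonempty
    · refine hgood σ S hS (fun x hx _ => e1 x hx) hEC ?_
      obtain ⟨x, hxS, n, hn⟩ := hmeet
      induction n generalizing x with
      | zero => exact ⟨x, hxS, hn⟩
      | succ n ih =>
        by_cases hxD : x ∈ D
        · exact ⟨x, hxS, hxD⟩
        rcases player_cases hP (ow x) with ho | ho | ho
        · obtain ⟨y, h1, h2, h3, h4⟩ := hEC.2.2.1 x hxS
          have := h4 ho
          rw [e2 x hxD ⟨_, hn⟩] at this
          exact ih y h2 (this ▸ (hσA n x hn hxD ho).2)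
        · rcases hn with hn | ⟨hxU, ⟨h, _⟩ | ⟨_, h⟩⟩
          · exact ih x hxS hn
          · exact absurd ho h
          · obtain ⟨y, h1, h2, h3, h4⟩ := hEC.2.2.1 x hxS
            exact ih y h2 (h y (hS h2) h3)
        · rcases hn with hn | ⟨hxU, ⟨_, y, hy, he⟩ | ⟨h, _⟩⟩
          · exact ih x hxS hn
          · exact ih y (hEC.2.1 x hxS ho y he) hy
          · rw [ho] at h; exact absurd h.symm (opp_ne_N hP)
    · have hsub : S ⊆ U \ Attr Ed ow P U D := fun x hx => ⟨hS hx, fun h => hmeet ⟨x, hx, h⟩⟩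
      exact hτ.2 S hsub (hEC.congr fun x hx _ => e3 x (hsub hx).2)

theorem glue_top [Finite X] {P : Player} (hP : P ≠ Player.N) {U : Set X} (hU : SubAr Ed ow U) (p : ℕ)
    (hp : ∀ x ∈ U, p ≤ pr x) (hg : goodP P p) (τ : X → X)
    (hτ : PWins Ed ow pr P (U \ Attr Ed ow P U {x | x ∈ U ∧ pr x = p}) τ) :
    ∃ σ, PWins Ed ow pr P U σ := by
  classical
  have : ∀ x, ∃ y, x ∈ U → y ∈ U ∧ Ed x y := fun x => by
    by_cases hx : x ∈ U
    · obtain ⟨y, hy, he⟩ := (hU x hx).1; exact ⟨y, fun _ => ⟨hy, he⟩⟩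
    · exact ⟨x, fun h => absurd h hx⟩
  choose σD hσD using this
  refine glue hP (fun x hx => hx.1) σD τ (fun x hx _ => ⟨(hσD x hx.1).2, (hσD x hx.1).1⟩) ?_ hτ
  rintro σ S hS _ _ ⟨x, hxS, hxU, hx⟩
  exact ⟨x, hxS, hx ▸ hg, fun y hy => hx ▸ hp y (hS hy)⟩

theorem dichotomy [Finite X] : ∀ (n : ℕ) (P : Player), P ≠ Player.N → ∀ U : Set X, SubAr Ed ow U →
    U.ncard = n → (∃ σ, PWins Ed ow pr P U σ) ∨ ∃ C π, WinTrap Ed ow pr (opp P) U C π := by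
  classical
  intro n
  induction n using Nat.strong_induction_on with
  | _ n IH =>
  intro P hP U hU hn
  rcases U.eq_empty_or_nonempty with rfl | hne
  · left
    refine ⟨id, fun x hx => absurd hx (Set.notMem_empty x), fun S hS hEC => ?_⟩
    obtain ⟨x, hx⟩ := hEC.1
    exact absurd (hS hx) (Set.notMem_empty x)
  have hsmall : ∀ (Q : Player) (D : Set X), D ⊆ U → D.Nonempty →
      (U \ Attr Ed ow Q U D).ncard < n := by
    rintro Q D hDU ⟨x, hx⟩
    rw [← hn]
    refine Set.ncard_lt_ncard ⟨fun a ha => ha.1, fun hsub => ?_⟩ (Set.toFinite _)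
    exact (hsub (hDU hx)).2 (subset_Attr hx)
  obtain ⟨x0, hx0, hmin⟩ := Set.exists_min_image U pr (Set.toFinite _) hne
  set D : Set X := {x | x ∈ U ∧ pr x = pr x0} with hDdef
  have hDU : D ⊆ U := fun x hx => hx.1
  have hDne : D.Nonempty := ⟨x0, hx0, rfl⟩
  by_cases hg : goodP P (pr x0)
  · rcases IH _ (hsmall P D hDU hDne) P hP _ (SubAr_compl hP hU) rfl with ⟨τ, hτ⟩ | ⟨C, π, h1, h2, h3, h4⟩
    · exact Or.inl (glue_top hP hU _ hmin hg τ hτ)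
    · refine Or.inr ⟨C, π, fun x hx => (h1 hx).1, h2, trap_lift h1 h3, h4⟩
  · have hg' := goodP_opp hP hg
    have hP' := opp_ne_N hP
    rcases IH _ (hsmall (opp P) D hDU hDne) (opp P) hP' _ (SubAr_compl hP' hU) rfl with
      ⟨τ, hτ⟩ | ⟨C, π, h1, h2, h3, h4⟩
    · obtain ⟨σ, hσ⟩ := glue_top hP' hU _ hmin hg' τ hτ
      exact Or.inr ⟨U, σ, subset_rfl, hne, fun x _ _ y hy _ => hy, hσ⟩
    · have h3' := trap_lift h1 h3
      rw [opp_opp] at h3' h4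
      have hCU : C ⊆ U := fun x hx => (h1 hx).1
      rcases IH _ (hsmall P C hCU h2) P hP _ (SubAr_compl hP hU) rfl with
        ⟨τ, hτ⟩ | ⟨B, π', k1, k2, k3, k4⟩
      · left
        refine glue hP hCU π τ (fun x hx ho => ⟨(h4.1 x hx ho).1, hCU (h4.1 x hx ho).2⟩) ?_ hτ
        rintro σ S hS hσ hEC ⟨c, hcS, hcC⟩
        have hSC : S ⊆ C := by
          intro y hy
          have hpath := hEC.2.2.2 c hcS y hy
          clear hy
          induction hpath with
          | refl => exact hcC
          | @tail b c _ hst ih =>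
            obtain ⟨a1, a2, a3, a4⟩ := hst
            by_cases ho : ow b = P
            · rw [a4 ho, hσ _ ih ho]; exact (h4.1 _ ih ho).2
            · exact h3' _ ih ho _ (hS a2) a3
        exact h4.2 S hSC (hEC.congr fun x hx ho => hσ x (hSC hx) ho)
      · exact Or.inr ⟨B, π', fun x hx => (k1 hx).1, k2, trap_lift k1 k3, k4⟩

/-! ### Strategy trees -/

section trees
variable {T : Type} (step : T → T → Prop) (lab : T → X)

def IsTr (Ed : X → X → Prop) (ow : X → Player) (P : Player) (σ : X → X) : Prop :=
  (∀ t, ∃ t', step t t') ∧ (∀ t t', step t t' → Ed (lab t) (lab t')) ∧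
  (∀ t y, ow (lab t) = Player.N → Ed (lab t) y → ∃ t', step t t' ∧ lab t' = y) ∧
  (∀ t t', step t t' → ow (lab t) = P → lab t' = σ (lab t))

def RR (t : T) : Set X := {x | ∃ t', Relation.ReflTransGen step t t' ∧ lab t' = x}

def Stab (t : T) : Prop := ∀ t', Relation.ReflTransGen step t t' → RR step lab t' = RR step lab t

variable {step lab}

theorem RR_mono {t t' : T} (h : Relation.ReflTransGen step t t') : RR step lab t' ⊆ RR step lab t := by
  rintro x ⟨u, hu, rfl⟩
  exact ⟨u, h.trans hu, rfl⟩

theorem Stab.mono {t t' : T} (hs : Stab step lab t) (h : Relation.ReflTransGen step t t') :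
    Stab step lab t' := fun u hu => by rw [hs u (h.trans hu), hs t' h]

theorem exists_stab [Finite X] (t : T) : ∃ t', Relation.ReflTransGen step t t' ∧ Stab step lab t' := by
  classical
  have hex : ∃ n t', Relation.ReflTransGen step t t' ∧ (RR step lab t').ncard = n :=
    ⟨_, t, .refl, rfl⟩
  obtain ⟨t', h1, h2⟩ := Nat.find_spec hex
  refine ⟨t', h1, fun u hu => ?_⟩
  refine Set.eq_of_subset_of_ncard_le (RR_mono hu) ?_ (Set.toFinite _)
  rw [h2]
  exact Nat.find_min' hex ⟨u, h1.trans hu, rfl⟩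

theorem stab_EC {P : Player} {σ : X → X} (hT : IsTr step lab Ed ow P σ) {t : T}
    (hs : Stab step lab t) : EC Ed ow P σ (RR step lab t) := by
  have hps : ∀ u u', Relation.ReflTransGen step t u → step u u' →
      PStep Ed ow P σ (RR step lab t) (lab u) (lab u') := fun u u' h h' =>
    ⟨⟨u, h, rfl⟩, ⟨u', h.tail h', rfl⟩, hT.2.1 _ _ h', hT.2.2.2 _ _ h'⟩
  refine ⟨⟨lab t, t, .refl, rfl⟩, ?_, ?_, ?_⟩
  · rintro x ⟨u, hu, rfl⟩ ho y he
    obtain ⟨u', h1, rfl⟩ := hT.2.2.1 u y ho he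
    exact ⟨u', hu.tail h1, rfl⟩
  · rintro x ⟨u, hu, rfl⟩
    obtain ⟨u', h1⟩ := hT.1 u
    exact ⟨_, hps u u' hu h1⟩
  · rintro x ⟨u, hu, rfl⟩ y hy
    rw [← hs u hu] at hy
    obtain ⟨u', hu', rfl⟩ := hy
    induction hu' with
    | refl => exact .refl
    | tail a b ih => exact ih.tail (hps _ _ (hu.trans a) b)

end trees

theorem partition [Finite X] : ∀ (n : ℕ) (U : Set X), SubAr Ed ow U → U.ncard = n →
    ∃ (W : Set X) (σ π : X → X), W ⊆ U ∧
      (∀ x ∈ W, ow x ≠ Player.E → ∀ y ∈ U, Ed x y → y ∈ W) ∧ PWins Ed ow pr Player.E W σ ∧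
      (∀ x ∈ U \ W, ow x = Player.A → Ed x (π x)) ∧
      ∀ (T : Type) (step : T → T → Prop) (lab : T → X) (π' : X → X),
        (∀ x ∈ U \ W, ow x = Player.A → π' x = π x) → IsTr step lab Ed ow Player.A π' →
        ∀ t, RR step lab t ⊆ U → lab t ∈ U \ W →
          ∃ u, Relation.ReflTransGen step t u ∧ Stab step lab u ∧ goodS pr Player.A (RR step lab u) := by
  classical
  intro n
  induction n using Nat.strong_induction_on with
  | _ n IH =>
  intro U hU hn
  have hA : Player.A ≠ Player.N := by decide
  rcases dichotomy (pr := pr) n Player.E (by decide) U hU hn with ⟨σ, hσ⟩ | ⟨B, πB, hBU, hBne, hBtrap, hBw⟩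
  · exact ⟨U, σ, id, subset_rfl, fun x _ _ y hy _ => hy, hσ, fun x hx => absurd hx.1 hx.2,
      fun T step lab π' _ _ t _ ht => absurd ht.1 ht.2⟩
  change ∀ x ∈ B, ow x ≠ Player.A → _ at hBtrap
  change PWins Ed ow pr Player.A B πB at hBw
  set Y := Attr Ed ow Player.A U B with hY
  have hsm : (U \ Y).ncard < n := by
    rw [← hn]
    refine Set.ncard_lt_ncard ⟨fun a ha => ha.1, fun hsub => ?_⟩ (Set.toFinite _)
    obtain ⟨x, hx⟩ := hBne
    exact (hsub (hBU hx)).2 (subset_Attr hx)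
  obtain ⟨W, σ, π, hWU, hWt, hWw, hπ, hsp⟩ := IH _ hsm (U \ Y) (SubAr_compl hA hU) rfl
  obtain ⟨πA, hπA⟩ := attr_strat (Ed := Ed) (ow := ow) hA U B
  let ψ : X → X := fun x => if x ∈ B then πB x else if x ∈ Y then πA x else π x
  have e1 : ∀ x ∈ B, ψ x = πB x := fun x hx => by simp [ψ, hx]
  have e2 : ∀ x ∉ B, x ∈ Y → ψ x = πA x := fun x hx hx' => by simp [ψ, hx, hx']
  have e3 : ∀ x ∉ Y, ψ x = π x := fun x hx => by
    have : x ∉ B := fun h => hx (subset_Attr h)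
    simp [ψ, hx, this]
  have hYW : ∀ x ∈ Y, x ∈ U \ W := fun x hx =>
    ⟨by obtain ⟨n, hn⟩ := hx; exact attr_sub hBU n hn, fun hW => (hWU hW).2 hx⟩
  refine ⟨W, σ, ψ, fun x hx => (hWU hx).1, trap_lift hWU hWt, hWw, ?_, ?_⟩
  · intro x hx ho
    by_cases hxB : x ∈ B
    · rw [e1 x hxB]; exact (hBw.1 x hxB ho).1
    · by_cases hxY : x ∈ Y
      · rw [e2 x hxB hxY]
        obtain ⟨n, hn⟩ := hxY
        cases n with
        | zero => exact absurd hn hxB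
        | succ m => exact (hπA m x hn hxB ho).1
      · rw [e3 x hxY]; exact hπ x ⟨⟨hx.1, hxY⟩, hx.2⟩ ho
  · intro T step lab π' hπ' hT t htU ht
    by_cases hmeet : (RR step lab t ∩ Y).Nonempty
    · obtain ⟨x, ⟨t1, ht1, rfl⟩, n, hn⟩ := hmeet
      have hreach : ∃ t2, Relation.ReflTransGen step t t2 ∧ lab t2 ∈ B := by
        clear hsm
        rename_i hnn
        clear hnn
        induction n generalizing t1 with
        | zero => exact ⟨t1, ht1, hn⟩
        | succ m ih =>
          by_cases hB : lab t1 ∈ B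
          · exact ⟨t1, ht1, hB⟩
          have hlY : lab t1 ∈ Y := ⟨_, hn⟩
          rcases player_cases hA (ow (lab t1)) with ho | ho | ho
          · obtain ⟨t', hs⟩ := hT.1 t1
            refine ih t' (ht1.tail hs) ?_
            rw [hT.2.2.2 _ _ hs ho, hπ' _ (hYW _ hlY) ho, e2 _ hB hlY]
            exact (hπA m _ hn hB ho).2
          · rcases hn with hn | ⟨hxU, ⟨h, _⟩ | ⟨_, h⟩⟩
            · exact ih t1 ht1 hn
            · exact absurd ho h
            · obtain ⟨t', hs⟩ := hT.1 t1
              exact ih t' (ht1.tail hs) (h _ (htU ⟨t', ht1.tail hs, rfl⟩) (hT.2.1 _ _ hs))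
          · rcases hn with hn | ⟨hxU, ⟨_, y, hy, he⟩ | ⟨h, _⟩⟩
            · exact ih t1 ht1 hn
            · obtain ⟨t', hs, rfl⟩ := hT.2.2.1 t1 y ho he
              exact ih t' (ht1.tail hs) hy
            · rw [ho] at h; exact absurd h.symm (opp_ne_N hA)
      obtain ⟨t2, ht2, hB2⟩ := hreach
      have hRB : RR step lab t2 ⊆ B := by
        rintro x ⟨u, hu, rfl⟩
        induction hu with
        | refl => exact hB2
        | @tail b' c' a b ih =>
          by_cases ho : ow (lab b') = Player.A
          · rw [hT.2.2.2 _ _ b ho, hπ' _ (hYW _ (subset_Attr ih)) ho, e1 _ ih]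
            exact (hBw.1 _ ih ho).2
          · exact hBtrap _ ih ho _ (htU ⟨_, ht2.trans (a.tail b), rfl⟩) (hT.2.1 _ _ b)
      obtain ⟨u, hu, hus⟩ := exists_stab (step := step) (lab := lab) t2
      have huB : RR step lab u ⊆ B := (RR_mono hu).trans hRB
      refine ⟨u, ht2.trans hu, hus, hBw.2 _ huB ((stab_EC hT hus).congr fun x hx ho => ?_)⟩
      rw [hπ' _ (hYW _ (subset_Attr (huB hx))) ho, e1 _ (huB hx)]
    · have hsub : RR step lab t ⊆ U \ Y := fun x hx => ⟨htU hx, fun h => hmeet ⟨x, hx, h⟩⟩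
      refine hsp T step lab π' (fun x hx ho => ?_) hT t hsub ⟨hsub ⟨t, .refl, rfl⟩, ht.2⟩
      rw [hπ' x ⟨hx.1.1, hx.2⟩ ho, e3 x hx.1.2]

end games

/-! ### Topology of the outcome tree -/

section topo
variable {V X : Type}

def Agr (n : ℕ) (p q : ℕ → V) : Prop := ∀ i ≤ n, p i = q i

theorem Agr.symm {n : ℕ} {p q : ℕ → V} (h : Agr n p q) : Agr n q p := fun i hi => (h i hi).symm
theorem Agr.trans {n : ℕ} {p q r : ℕ → V} (h : Agr n p q) (h' : Agr n q r) : Agr n p r :=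
  fun i hi => (h i hi).trans (h' i hi)
theorem Agr.le {n m : ℕ} {p q : ℕ → V} (h : Agr n p q) (hm : m ≤ n) : Agr m p q :=
  fun i hi => h i (hi.trans hm)
theorem Agr.rfl' {n : ℕ} {p : ℕ → V} : Agr n p p := fun _ _ => rfl

theorem hist_congr {n : ℕ} {p q : ℕ → V} (h : Agr n p q) : histUpTo p n = histUpTo q n := by
  unfold histUpTo
  congr 1
  funext j
  exact h j.1 (by omega)

theorem hist_succ (p : ℕ → V) (n : ℕ) : histUpTo p (n + 1) = histUpTo p n ++ [p (n + 1)] := by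
  unfold histUpTo
  rw [List.ofFn_succ_last]
  simp

theorem hist_length (p : ℕ → V) (n : ℕ) : (histUpTo p n).length = n + 1 := by simp [histUpTo]

theorem hist_last (p : ℕ → V) (n : ℕ) : ∃ l, histUpTo p n = l ++ [p n] := by
  cases n with
  | zero => exact ⟨[], by simp [histUpTo]⟩
  | succ n => exact ⟨_, hist_succ p n⟩

theorem hist_getElem (p : ℕ → V) (n i : ℕ) (h : i < (histUpTo p n).length) :
    (histUpTo p n)[i] = p i := by
  have h1 : i < (List.ofFn (fun j : Fin (n + 1) => p j.1)).length := h
  exact List.getElem_ofFn h1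

theorem bprefix_hist {p q : ℕ → V} {n : ℕ} : BPrefix p (histUpTo q n) ↔ Agr n p q := by
  constructor
  · intro h i hi
    have := h ⟨i, by rw [hist_length]; omega⟩
    rwa [List.get_eq_getElem, hist_getElem] at this
  · intro h i
    have hi : i.1 < n + 1 := lt_of_lt_of_eq i.2 (hist_length q n)
    rw [List.get_eq_getElem, hist_getElem]
    exact h i.1 (by omega)

theorem prefix_hist {p : ℕ → V} {u : List V} {n : ℕ} (h : BPrefix p u) (hn : u.length ≤ n) :
    u <+: histUpTo p n := by
  rw [List.prefix_iff_eq_take]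
  apply List.ext_getElem
  · simp [hist_length]; omega
  · intro i h1 h2
    have := h ⟨i, h1⟩
    rw [List.getElem_take, hist_getElem]
    exact this.symm

theorem bprefix_congr {p q : ℕ → V} {u : List V} {n : ℕ} (h : BPrefix p u) (hn : u.length ≤ n)
    (ha : Agr n p q) : BPrefix q u := by
  intro i
  rw [← h i]
  exact (ha i.1 (by have := i.2; omega)).symm

theorem bprefix_of_prefix {p : ℕ → V} {u v : List V} (h : BPrefix p v) (hu : u <+: v) :
    BPrefix p u := by
  intro i
  have h2 := hu.length_le
  have := h ⟨i.1, lt_of_lt_of_le i.2 h2⟩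
  rw [this]
  simp only [List.get_eq_getElem]
  exact (hu.getElem i.2).symm

variable (P : Set (ℕ → V)) (L : (ℕ → V) → ℕ → X)

def NodeT : Type := {x : (ℕ → V) × ℕ // x.1 ∈ P}
variable {P} in
def nstep (t t' : NodeT P) : Prop := t'.1.2 = t.1.2 + 1 ∧ Agr t.1.2 t.1.1 t'.1.1
variable {P} in
def nlab (t : NodeT P) : X := L t.1.1 t.1.2

variable {P L}

def nd (p : ℕ → V) (hp : p ∈ P) (n : ℕ) : NodeT P := ⟨(p, n), hp⟩

theorem rtg_agr {t t' : NodeT P} (h : Relation.ReflTransGen nstep t t') :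
    t.1.2 ≤ t'.1.2 ∧ Agr t.1.2 t.1.1 t'.1.1 := by
  induction h with
  | refl => exact ⟨le_rfl, Agr.rfl'⟩
  | tail _ hs ih =>
    obtain ⟨h1, h2⟩ := hs
    exact ⟨by omega, ih.2.trans (h2.le ih.1)⟩

theorem rtg_self (p : ℕ → V) (hp : p ∈ P) {n m : ℕ} (h : n ≤ m) :
    Relation.ReflTransGen nstep (nd p hp n) (nd p hp m) := by
  induction m, h using Nat.le_induction with
  | base => exact .refl
  | succ m _ ih => exact ih.tail ⟨rfl, Agr.rfl'⟩

theorem rtg_of_agr {p q : ℕ → V} (hp : p ∈ P) (hq : q ∈ P) {n m : ℕ} (h : n < m) (ha : Agr n p q) :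
    Relation.ReflTransGen nstep (nd p hp n) (nd q hq m) :=
  Relation.ReflTransGen.head (b := nd q hq (n + 1)) ⟨rfl, ha⟩ (rtg_self q hq h)

variable (hL : ∀ n p q, Agr n p q → L p n = L q n)
include hL

theorem mem_RR {t : NodeT P} {x : X} : x ∈ RR nstep (nlab L) t ↔
    ∃ q, q ∈ P ∧ ∃ k ≥ t.1.2, Agr t.1.2 t.1.1 q ∧ L q k = x := by
  constructor
  · rintro ⟨u, hu, rfl⟩
    obtain ⟨h1, h2⟩ := rtg_agr hu
    exact ⟨u.1.1, u.2, u.1.2, h1, h2, rfl⟩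
  · rintro ⟨q, hq, k, hk, ha, rfl⟩
    rcases hk.lt_or_eq with h | h
    · exact ⟨nd q hq k, rtg_of_agr t.2 hq h ha, rfl⟩
    · refine ⟨t, .refl, ?_⟩
      rw [← h]
      exact hL _ _ _ ha

theorem RR_congr {p q : ℕ → V} (hp : p ∈ P) (hq : q ∈ P) {n : ℕ} (ha : Agr n p q) :
    RR nstep (nlab L) (nd p hp n) = RR nstep (nlab L) (nd q hq n) := by
  ext x
  rw [mem_RR hL, mem_RR hL]
  constructor
  · rintro ⟨r, hr, k, hk, h, h'⟩
    exact ⟨r, hr, k, hk, ha.symm.trans h, h'⟩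
  · rintro ⟨r, hr, k, hk, h, h'⟩
    exact ⟨r, hr, k, hk, ha.trans h, h'⟩

theorem Stab_congr {p q : ℕ → V} (hp : p ∈ P) (hq : q ∈ P) {n : ℕ} (ha : Agr n p q)
    (hs : Stab nstep (nlab L) (nd p hp n)) : Stab nstep (nlab L) (nd q hq n) := by
  intro u hu
  obtain ⟨h1, h2⟩ := rtg_agr hu
  rw [← RR_congr hL hp hq ha]
  rcases h1.lt_or_eq with h | h
  · exact hs u (rtg_of_agr hp u.2 h (ha.trans h2))
  · obtain ⟨⟨r, k⟩, hr⟩ := u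
    change n = k at h
    subst h
    exact (RR_congr hL hp hr (ha.trans h2)).symm

omit hL
noncomputable def mnp (pr : X → ℕ) (S : Set X) : ℕ := sInf (pr '' S)

theorem mnp_le {pr : X → ℕ} {S : Set X} {x : X} (hx : x ∈ S) : mnp pr S ≤ pr x :=
  Nat.sInf_le ⟨x, hx, rfl⟩

theorem mnp_mem {pr : X → ℕ} {S : Set X} (h : S.Nonempty) : ∃ x ∈ S, pr x = mnp pr S :=
  Nat.sInf_mem (h.image pr)

theorem goodS_mnp {pr : X → ℕ} {S : Set X} {Q : Player} (h : goodS pr Q S) : goodP Q (mnp pr S) := by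
  obtain ⟨x, hx, h1, h2⟩ := h
  have : pr x = mnp pr S := by
    obtain ⟨y, hy, h3⟩ := mnp_mem (pr := pr) ⟨x, hx⟩
    exact le_antisymm (h3 ▸ h2 y hy) (mnp_le hx)
  rwa [← this]

def DD (P : Set (ℕ → V)) (L : (ℕ → V) → ℕ → X) (pr : X → ℕ) (n : ℕ) : Set (ℕ → V) :=
  {b | ∃ hb : b ∈ P, ¬ ∃ m k, Stab nstep (nlab L) (nd b hb m) ∧ n ≤ k ∧
    pr (L b k) = mnp pr (RR nstep (nlab L) (nd b hb m))}

include hL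
theorem DD_nd [Finite X] (pr : X → ℕ) (n : ℕ) : NowhereDenseIn P (DD P L pr n) := by
  rintro u ⟨p, hp, hpu⟩
  obtain ⟨⟨⟨p1, m1⟩, hp1⟩, h1, hs⟩ := exists_stab (step := nstep) (lab := nlab L)
    (nd p hp (max u.length n))
  obtain ⟨h2, h3⟩ := rtg_agr h1
  change max u.length n ≤ m1 at h2
  change Agr (max u.length n) p p1 at h3
  obtain ⟨x, hx, hxm⟩ := mnp_mem (pr := pr) (S := RR nstep (nlab L) (nd p1 hp1 m1)) ⟨_, _, .refl, rfl⟩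
  obtain ⟨p2, hp2, k, hk, ha, rfl⟩ := (mem_RR hL).1 hx
  change m1 ≤ k at hk
  change Agr m1 p1 p2 at ha
  have hu : BPrefix p2 u := bprefix_congr hpu (le_max_left _ n) (h3.trans (ha.le h2))
  refine ⟨histUpTo p2 k, ⟨p2, hp2, bprefix_hist.2 Agr.rfl'⟩, prefix_hist hu ?_, ?_⟩
  · exact ((le_max_left _ _).trans h2).trans hk
  · rintro b ⟨hb, hnb⟩ hbp
    have hbk := bprefix_hist.1 hbp
    have hab : Agr m1 p1 b := ha.trans (hbk.le hk).symm
    refine hnb ⟨m1, k, Stab_congr hL hp1 hb hab hs, ((le_max_right _ _).trans h2).trans hk, ?_⟩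
    rw [← RR_congr hL hp1 hb hab, ← hxm, hL k b p2 hbk]

theorem DD_avoid (pr : X → ℕ) {b : ℕ → V} (hb : b ∈ P) (h : ∀ n, b ∉ DD P L pr n) :
    (∃ m, Stab nstep (nlab L) (nd b hb m)) ∧ ∀ m, Stab nstep (nlab L) (nd b hb m) →
      LimInf (fun k => pr (L b k)) (mnp pr (RR nstep (nlab L) (nd b hb m))) := by
  have h' : ∀ n, ∃ m k, Stab nstep (nlab L) (nd b hb m) ∧ n ≤ k ∧
    pr (L b k) = mnp pr (RR nstep (nlab L) (nd b hb m)) := fun n => by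
    by_contra hc
    exact h n ⟨hb, hc⟩
  refine ⟨?_, fun m hm => ⟨fun N => ?_, m, fun k hk => ?_⟩⟩
  · obtain ⟨m, _, hm, _⟩ := h' 0
    exact ⟨m, hm⟩
  · obtain ⟨m', k, h1, h2, h3⟩ := h' N
    refine ⟨k, h2, ?_⟩
    change pr (L b k) = _
    rw [h3, ← hm _ (rtg_self b hb (le_max_left m m')), ← h1 _ (rtg_self b hb (le_max_right m m'))]
  · exact mnp_le ((mem_RR hL).2 ⟨b, hb, k, hk, Agr.rfl', rfl⟩)

omit hL

theorem baire (hcl : ∀ b : ℕ → V, (∀ n, ∃ p ∈ P, Agr n p b) → b ∈ P) (f : ℕ → Set (ℕ → V))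
    (hf : ∀ n, NowhereDenseIn P (f n)) (t : NodeT P) :
    ∃ b ∈ P, Agr t.1.2 t.1.1 b ∧ ∀ n, b ∉ f n := by
  have key : ∀ (n : ℕ) (s : NodeT P), ∃ s' : NodeT P, s.1.2 < s'.1.2 ∧ Agr s.1.2 s.1.1 s'.1.1 ∧
      ∀ b, Agr s'.1.2 s'.1.1 b → b ∉ f n := by
    rintro n ⟨⟨p, m⟩, hp⟩
    obtain ⟨v, ⟨p', hp', hv⟩, huv, hb⟩ := hf n (histUpTo p m) ⟨p, hp, bprefix_hist.2 Agr.rfl'⟩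
    refine ⟨nd p' hp' (max v.length (m + 1)), ?_, ?_, fun b h hbf => hb b hbf ?_⟩
    · change m < max v.length (m + 1)
      exact lt_of_lt_of_le (Nat.lt_succ_self m) (le_max_right _ _)
    · exact (bprefix_hist.1 (bprefix_of_prefix hv huv)).symm
    · exact bprefix_congr hv (le_max_left _ _) h
  choose F hF1 hF2 hF3 using key
  let s : ℕ → NodeT P := fun n => Nat.rec t (fun n x => F n x) n
  have hs1 : ∀ n, (s n).1.2 < (s (n + 1)).1.2 := fun n => hF1 n (s n)
  have hs2 : ∀ n, Agr (s n).1.2 (s n).1.1 (s (n + 1)).1.1 := fun n => hF2 n (s n)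
  have hs3 : ∀ n b, Agr (s (n + 1)).1.2 (s (n + 1)).1.1 b → b ∉ f n := fun n => hF3 n (s n)
  have hmono : StrictMono fun n => (s n).1.2 := strictMono_nat_of_lt_succ hs1
  have hagr : ∀ n k, n ≤ k → Agr (s n).1.2 (s n).1.1 (s k).1.1 := by
    intro n k h
    induction k, h using Nat.le_induction with
    | base => exact Agr.rfl'
    | succ k hk ih => exact ih.trans ((hs2 k).le (hmono.monotone hk))
  let b : ℕ → V := fun k => (s k).1.1 k
  have hb : ∀ n, Agr (s n).1.2 (s n).1.1 b := by
    intro n i hi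
    rcases le_total i n with h | h
    · exact (hagr i n h i (hmono.id_le i)).symm
    · exact hagr n i h i hi
  exact ⟨b, hcl b fun n => ⟨_, (s n).2, (hb n).le (hmono.id_le n)⟩, hb 0, fun n => hs3 n b (hb (n + 1))⟩

theorem LimInf.uniq {s : ℕ → ℕ} {p q : ℕ} (h : LimInf s p) (h' : LimInf s q) : p = q := by
  obtain ⟨h1, N, h2⟩ := h
  obtain ⟨h3, M, h4⟩ := h'
  obtain ⟨k, hk, rfl⟩ := h1 M
  obtain ⟨j, hj, rfl⟩ := h3 N
  exact le_antisymm (h2 j hj) (h4 k hk)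

include hL
theorem meager_of_good [Finite X] (pr : X → ℕ) (Ω : Set (ℕ → V))
    (hΩ : ∀ b ∈ P, ∃ p, LimInf (fun k => pr (L b k)) p ∧ (b ∈ Ω ↔ Even p))
    (hg : ∀ t : NodeT P, Stab nstep (nlab L) t → goodS pr Player.E (RR nstep (nlab L) t)) :
    MeagerIn P (P \ Ω) := by
  refine ⟨DD P L pr, DD_nd hL pr, ?_⟩
  rintro b ⟨hb, hbΩ⟩
  by_contra hc
  simp only [Set.mem_iUnion, not_exists] at hc
  obtain ⟨⟨m, hm⟩, h2⟩ := DD_avoid hL pr hb hc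
  obtain ⟨p, hp, hpe⟩ := hΩ b hb
  have := hp.uniq (h2 m hm)
  rw [this] at hpe
  exact hbΩ (hpe.2 (goodS_mnp (hg _ hm)))

theorem not_meager_of_bad [Finite X] (pr : X → ℕ) (Ω : Set (ℕ → V))
    (hcl : ∀ b : ℕ → V, (∀ n, ∃ p ∈ P, Agr n p b) → b ∈ P)
    (hΩ : ∀ b ∈ P, ∃ p, LimInf (fun k => pr (L b k)) p ∧ (b ∈ Ω ↔ Even p))
    (t : NodeT P) (ht : Stab nstep (nlab L) t) (hg : goodS pr Player.A (RR nstep (nlab L) t)) :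
    ¬ MeagerIn P (P \ Ω) := by
  rintro ⟨f, hf, hsub⟩
  obtain ⟨⟨q, m⟩, hq⟩ := t
  obtain ⟨b, hb, hab, hav⟩ := baire hcl
    (fun n => if Even n then f (n / 2) else DD P L pr (n / 2)) (fun n => by
      split_ifs
      · exact hf _
      · exact DD_nd hL pr _) ⟨(q, m), hq⟩
  change Agr m q b at hab
  have h1 : ∀ n, b ∉ f n := fun n => by
    have := hav (2 * n)
    simpa using this
  have h2 : ∀ n, b ∉ DD P L pr n := fun n => by
    have := hav (2 * n + 1)
    have e : (2 * n + 1) / 2 = n := by omega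
    rw [if_neg (by simp), e] at this
    exact this
  obtain ⟨p, hp, hpe⟩ := hΩ b hb
  have h3 := (DD_avoid hL pr hb h2).2 m (Stab_congr hL hq hb hab ht)
  rw [hp.uniq h3, ← RR_congr hL hq hb hab] at hpe
  have hbO : b ∉ Ω := fun h => goodS_mnp hg (hpe.1 h)
  obtain ⟨n, hn⟩ := Set.mem_iUnion.1 (hsub ⟨hb, hbO⟩)
  exact h1 n hn

end topo

/-! ### Assembly -/

section assembly
variable {V : Type} {A : Arena V} {v0 : V} {φE φA : List V → V}

def ValidAt (A : Arena V) (φE φA : List V → V) (p : ℕ → V) (i : ℕ) : Prop :=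
  A.Edge (p i) (p (i + 1)) ∧ (A.owner (p i) = Player.E → p (i + 1) = φE (histUpTo p i)) ∧
    (A.owner (p i) = Player.A → p (i + 1) = φA (histUpTo p i))

theorem mem_out {p : ℕ → V} :
    p ∈ Outcomes A v0 φE φA ↔ p 0 = v0 ∧ ∀ i, ValidAt A φE φA p i := by
  constructor
  · rintro ⟨⟨h1, h2⟩, h3, h4⟩
    exact ⟨h1, fun i => ⟨h2 i, h3 i, h4 i⟩⟩
  · rintro ⟨h1, h2⟩
    exact ⟨⟨h1, fun i => (h2 i).1⟩, fun i => (h2 i).2.1, fun i => (h2 i).2.2⟩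

theorem valid_congr {p q : ℕ → V} {i : ℕ} (h : Agr (i + 1) p q) (hv : ValidAt A φE φA p i) :
    ValidAt A φE φA q i := by
  unfold ValidAt at *
  rwa [← h i (by omega), ← h (i + 1) le_rfl, ← hist_congr (h.le (Nat.le_succ i))]

theorem out_closed (b : ℕ → V) (h : ∀ n, ∃ p ∈ Outcomes A v0 φE φA, Agr n p b) :
    b ∈ Outcomes A v0 φE φA := by
  rw [mem_out]
  constructor
  · obtain ⟨p, hp, ha⟩ := h 0
    rw [← ha 0 le_rfl]
    exact (mem_out.1 hp).1
  · intro i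
    obtain ⟨p, hp, ha⟩ := h (i + 1)
    exact valid_congr ha ((mem_out.1 hp).2 i)

theorem exists_rec (v0 : V) (nx : List V → V) :
    ∃ p : ℕ → V, p 0 = v0 ∧ ∀ k, p (k + 1) = nx (histUpTo p k) := by
  let H : ℕ → List V := fun n => Nat.rec [v0] (fun _ l => l ++ [nx l]) n
  let p : ℕ → V := fun n => Nat.casesOn n v0 (fun k => nx (H k))
  have hH : ∀ k, histUpTo p k = H k := by
    intro k
    induction k with
    | zero => simp [histUpTo, p, H]
    | succ k ih => rw [hist_succ, ih]
  exact ⟨p, rfl, fun k => by rw [hH]⟩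

theorem out_ext (hE : IsStrategyFor A Player.E φE) (hA : IsStrategyFor A Player.A φA)
    (p : ℕ → V) (n : ℕ) (h0 : p 0 = v0) (hv : ∀ i < n, ValidAt A φE φA p i) :
    ∃ q ∈ Outcomes A v0 φE φA, Agr n p q := by
  classical
  choose sc hsc using A.no_dead
  let nx : List V → V := fun l => if l.length ≤ n then p l.length else
    match A.owner (l.getLast?.getD v0) with
    | Player.E => φE l
    | Player.A => φA l
    | Player.N => sc (l.getLast?.getD v0)
  obtain ⟨q, hq0, hq⟩ := exists_rec v0 nx
  have hag : Agr n p q := by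
    intro i hi
    cases i with
    | zero => rw [h0, hq0]
    | succ i =>
      rw [hq]
      simp [nx, hist_length, hi]
  refine ⟨q, mem_out.2 ⟨hq0, fun i => ?_⟩, hag⟩
  by_cases hi : i < n
  · exact valid_congr (hag.le hi) (hv i hi)
  · obtain ⟨l, hl⟩ := hist_last q i
    have hlast : (histUpTo q i).getLast?.getD v0 = q i := by rw [hl]; simp
    have hlen : ¬ (histUpTo q i).length ≤ n := by rw [hist_length]; omega
    have hqi : q (i + 1) = match A.owner (q i) with
      | Player.E => φE (histUpTo q i)
      | Player.A => φA (histUpTo q i)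
      | Player.N => sc (q i) := by
      rw [hq]
      simp only [nx, if_neg hlen, hlast]
    unfold ValidAt
    rcases ho : A.owner (q i) with _ | _ | _
    · rw [ho] at hqi
      refine ⟨?_, fun _ => hqi, fun h => (by cases h)⟩
      rw [hqi, hl]; exact hE l _ ho
    · rw [ho] at hqi
      refine ⟨?_, fun h => (by cases h), fun _ => hqi⟩
      rw [hqi, hl]; exact hA l _ ho
    · rw [ho] at hqi
      refine ⟨?_, fun h => (by cases h), fun h => (by cases h)⟩
      rw [hqi]; exact hsc _

variable {Qs : Type} (up : Qs → V → Qs) (m0 : Qs)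

def runQ (p : ℕ → V) : ℕ → Qs
  | 0 => m0
  | k + 1 => up (runQ p k) (p (k + 1))

def labL (p : ℕ → V) (k : ℕ) : V × Qs := (p k, runQ up m0 p k)

theorem runQ_congr {n : ℕ} {p q : ℕ → V} (h : Agr n p q) : runQ up m0 p n = runQ up m0 q n := by
  induction n with
  | zero => rfl
  | succ n ih => rw [runQ, runQ, ih (h.le (Nat.le_succ n)), h (n + 1) le_rfl]

theorem labL_congr (n : ℕ) (p q : ℕ → V) (h : Agr n p q) : labL up m0 p n = labL up m0 q n := by
  unfold labL
  rw [h n le_rfl, runQ_congr up m0 h]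

theorem foldl_run (p : ℕ → V) (n : ℕ) : (histUpTo p n).tail.foldl up m0 = runQ up m0 p n := by
  induction n with
  | zero => simp [histUpTo, runQ]
  | succ n ih =>
    have hne : histUpTo p n ≠ [] := by
      intro h
      have := hist_length p n
      rw [h] at this
      simp at this
    rw [hist_succ, List.tail_append_of_ne_nil hne, List.foldl_append, ih]
    rfl

def EdX (A : Arena V) (up : Qs → V → Qs) (x y : V × Qs) : Prop :=
  A.Edge x.1 y.1 ∧ y.2 = up x.2 y.1

def owX (A : Arena V) (x : V × Qs) : Player := A.owner x.1

/-- the finite-memory strategy given by a positional strategy on the product -/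
def posStrat (dflt : V) (σ : V × Qs → V × Qs) (l : List V) : V :=
  (σ (l.getLast?.getD dflt, l.tail.foldl up m0)).1

theorem posStrat_fm [Finite Qs] (dflt : V) (σ : V × Qs → V × Qs) :
    FiniteMemoryF (posStrat up m0 dflt σ) :=
  ⟨Qs, inferInstance, m0, up, fun q v => (σ (v, q)).1, fun l v => by simp [posStrat]⟩

theorem posStrat_is (dflt : V) (σ : V × Qs → V × Qs) (Pl : Player)
    (h : ∀ x : V × Qs, A.owner x.1 = Pl → EdX A up x (σ x)) :
    IsStrategyFor A Pl (posStrat up m0 dflt σ) := by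
  intro l v hv
  have := (h (v, (l ++ [v]).tail.foldl up m0) hv).1
  simpa [posStrat] using this

theorem posStrat_hist (dflt : V) (σ : V × Qs → V × Qs) (p : ℕ → V) (n : ℕ) :
    posStrat up m0 dflt σ (histUpTo p n) = (σ (labL up m0 p n)).1 := by
  obtain ⟨l, hl⟩ := hist_last p n
  unfold posStrat
  rw [foldl_run, hl]
  simp [labL]

theorem out_IsTr (hE : IsStrategyFor A Player.E φE) (hA : IsStrategyFor A Player.A φA)
    (σ : V × Qs → V × Qs) (Pl : Player)
    (hσ : ∀ x : V × Qs, A.owner x.1 = Pl → EdX A up x (σ x))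
    (hfol : ∀ p ∈ Outcomes A v0 φE φA, ∀ n, A.owner (p n) = Pl →
      p (n + 1) = (σ (labL up m0 p n)).1) :
    IsTr (T := NodeT (Outcomes A v0 φE φA)) nstep (nlab (labL up m0)) (EdX A up) (owX A) Pl σ := by
  have hed : ∀ t t' : NodeT (Outcomes A v0 φE φA), nstep t t' →
      EdX A up (nlab (labL up m0) t) (nlab (labL up m0) t') := by
    rintro ⟨⟨p, n⟩, hp⟩ ⟨⟨q, m⟩, hq⟩ ⟨h1, h2⟩
    change m = n + 1 at h1
    subst h1
    change Agr n p q at h2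
    change EdX A up (labL up m0 p n) (labL up m0 q (n + 1))
    rw [labL_congr up m0 n p q h2]
    exact ⟨((mem_out.1 hq).2 n).1, rfl⟩
  refine ⟨fun t => ⟨nd t.1.1 t.2 (t.1.2 + 1), rfl, Agr.rfl'⟩, hed, ?_, ?_⟩
  · rintro ⟨⟨p, n⟩, hp⟩ ⟨w, q'⟩ ho ⟨he, hq'⟩
    change A.owner (p n) = Player.N at ho
    change A.Edge (p n) w at he
    change q' = up (runQ up m0 p n) w at hq'
    let r : ℕ → V := fun i => if i = n + 1 then w else p i
    have hr1 : r (n + 1) = w := by simp [r]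
    have hr2 : Agr n p r := by
      intro i hi
      have : i ≠ n + 1 := by omega
      simp [r, this]
    have hpo := mem_out.1 hp
    obtain ⟨q, hq, hqa⟩ := out_ext (v0 := v0) hE hA r (n + 1)
      (by rw [← hr2 0 (Nat.zero_le _)]; exact hpo.1) (by
        intro i hi
        rcases Nat.lt_succ_iff_lt_or_eq.1 hi with h | rfl
        · exact valid_congr (hr2.le h) (hpo.2 i)
        · have e : r i = p i := (hr2 i le_rfl).symm
          refine ⟨?_, fun h => ?_, fun h => ?_⟩
          · rw [e, hr1]; exact he
          · rw [e, ho] at h; cases h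
          · rw [e, ho] at h; cases h)
    have hpq : Agr n p q := hr2.trans (hqa.le (Nat.le_succ n))
    have hw : q (n + 1) = w := by rw [← hqa (n + 1) le_rfl, hr1]
    refine ⟨nd q hq (n + 1), ⟨rfl, hpq⟩, ?_⟩
    change (q (n + 1), up (runQ up m0 q n) (q (n + 1))) = (w, q')
    rw [hw, hq', runQ_congr up m0 hpq]
  · intro t t' hst ho
    have h1 := hed t t' hst
    obtain ⟨⟨p, n⟩, hp⟩ := t
    obtain ⟨⟨q, m⟩, hq⟩ := t'
    obtain ⟨h2, h3⟩ := hst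
    change m = n + 1 at h2
    subst h2
    change Agr n p q at h3
    change A.owner (p n) = Pl at ho
    change EdX A up (labL up m0 p n) (labL up m0 q (n + 1)) at h1
    change labL up m0 q (n + 1) = σ (labL up m0 p n)
    have h4 : q (n + 1) = (σ (labL up m0 p n)).1 := by
      rw [labL_congr up m0 n p q h3]
      exact hfol q hq n (by rw [← h3 n le_rfl]; exact ho)
    have h5 := hσ (labL up m0 p n) ho
    refine Prod.ext h4 ?_
    rw [h1.2, h5.2]
    congr 1

end assembly
/-- In a game with Nature on a finite arena with an ω-regular
winning condition, Éloïse has a topologically-good strategy iff she has a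
finite-memory strategy `φ_E` such that against every finite-memory Abélard
strategy the set of plays lost by Éloïse is meager in the tree of outcomes. -/
theorem stmt8 {V : Type} [Fintype V] (A : Arena V) (v0 : V)
    (Ω : Set (ℕ → V)) (hΩ : OmegaRegularWC Ω) :
    (∃ φE, IsStrategyFor A Player.E φE ∧ TopGood A v0 Ω φE) ↔
    (∃ φE, IsStrategyFor A Player.E φE ∧ FiniteMemoryF φE ∧
      ∀ φA, IsStrategyFor A Player.A φA → FiniteMemoryF φA →
        MeagerIn (Outcomes A v0 φE φA) (Outcomes A v0 φE φA \ Ω)) := by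
  classical
  obtain ⟨Qs, hQs, start, up, prQ, hdpa⟩ := exists_dpa Ω hΩ
  let m0 : Qs := start v0
  let pr : V × Qs → ℕ := fun x => prQ x.2
  have hSub : SubAr (EdX A up) (owX A) (Set.univ : Set (V × Qs)) := by
    intro x _
    obtain ⟨w, hw⟩ := A.no_dead x.1
    exact ⟨⟨(w, up x.2 w), trivial, hw, rfl⟩, fun _ _ _ => trivial⟩
  obtain ⟨W, σ, π, -, hWt, hWw, hπ, hbad⟩ := partition (pr := pr) _ _ hSub rfl
  have hpatch : ∀ τ : V × Qs → V × Qs, ∃ τ' : V × Qs → V × Qs,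
      (∀ x, EdX A up x (τ' x)) ∧ ∀ x, EdX A up x (τ x) → τ' x = τ x := by
    intro τ
    have : ∀ x, ∃ y, EdX A up x y ∧ (EdX A up x (τ x) → y = τ x) := by
      intro x
      by_cases h : EdX A up x (τ x)
      · exact ⟨τ x, h, fun _ => rfl⟩
      · obtain ⟨w, hw⟩ := A.no_dead x.1
        exact ⟨(w, up x.2 w), ⟨hw, rfl⟩, fun h' => absurd h' h⟩
    choose τ' h1 h2 using this
    exact ⟨τ', h1, h2⟩
  have hLc := labL_congr up m0
  have hOm : ∀ φE φA, ∀ b ∈ Outcomes A v0 φE φA,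
      ∃ p, LimInf (fun k => pr (labL up m0 b k)) p ∧ (b ∈ Ω ↔ Even p) := by
    intro φE φA b hb
    refine hdpa b (runQ up m0 b) ?_ (fun k => rfl)
    rw [(mem_out.1 hb).1]
    rfl
  obtain ⟨σ', hσ1, hσ2⟩ := hpatch σ
  obtain ⟨π', hπ1, hπ2⟩ := hpatch π
  have hSE : IsStrategyFor A Player.E (posStrat up m0 v0 σ') :=
    posStrat_is up m0 v0 σ' Player.E fun x _ => hσ1 x
  have hSA : IsStrategyFor A Player.A (posStrat up m0 v0 π') :=
    posStrat_is up m0 v0 π' Player.A fun x _ => hπ1 x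
  -- the case where the initial position is outside the winning region
  have hout : (v0, m0) ∉ W → ∀ φE, IsStrategyFor A Player.E φE →
      ¬ MeagerIn (Outcomes A v0 φE (posStrat up m0 v0 π'))
        (Outcomes A v0 φE (posStrat up m0 v0 π') \ Ω) := by
    intro hx φE hE
    have hTr := out_IsTr (v0 := v0) up m0 hE hSA π' Player.A (fun x _ => hπ1 x) (by
      intro p hp n ho
      rw [← posStrat_hist up m0 v0]
      exact ((mem_out.1 hp).2 n).2.2 ho)
    obtain ⟨q, hq, -⟩ := out_ext (v0 := v0) hE hSA (fun _ => v0) 0 rfl (fun i hi => absurd hi (by omega))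
    have hq0 : labL up m0 q 0 = (v0, m0) := by
      have := (mem_out.1 hq).1
      simp [labL, runQ, this]
    obtain ⟨u, -, hus, hug⟩ := hbad _ _ _ π' (fun x hxU ho => hπ2 x (hπ x hxU ho)) hTr (nd q hq 0)
      (Set.subset_univ _) ⟨trivial, by
        change labL up m0 q 0 ∉ W
        rw [hq0]; exact hx⟩
    exact not_meager_of_bad hLc pr Ω out_closed (hOm _ _) u hus hug
  -- the case where the initial position is inside the winning region
  have hin : (v0, m0) ∈ W → TopGood A v0 Ω (posStrat up m0 v0 σ') := by
    intro hx φA hA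
    have hTr := out_IsTr (v0 := v0) up m0 hSE hA σ' Player.E (fun x _ => hσ1 x) (by
      intro p hp n ho
      rw [← posStrat_hist up m0 v0]
      exact ((mem_out.1 hp).2 n).2.1 ho)
    have hag : ∀ x ∈ W, owX A x = Player.E → σ' x = σ x := fun x hxW ho =>
      hσ2 x (hWw.1 x hxW ho).1
    have hstay : ∀ p ∈ Outcomes A v0 (posStrat up m0 v0 σ') φA, ∀ n, labL up m0 p n ∈ W := by
      intro p hp n
      induction n with
      | zero =>
        have := (mem_out.1 hp).1
        have e : labL up m0 p 0 = (v0, m0) := by simp [labL, runQ, this]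
        rw [e]; exact hx
      | succ n ih =>
        have hst : nstep (nd p hp n) (nd p hp (n + 1)) := ⟨rfl, Agr.rfl'⟩
        by_cases ho : owX A (labL up m0 p n) = Player.E
        · have h1 : labL up m0 p (n + 1) = σ' (labL up m0 p n) := hTr.2.2.2 _ _ hst ho
          rw [h1, hag _ ih ho]
          exact (hWw.1 _ ih ho).2
        · exact hWt _ ih ho _ trivial (hTr.2.1 _ _ hst)
    refine meager_of_good hLc pr Ω (hOm _ _) fun t ht => ?_
    have hRW : RR nstep (nlab (labL up m0)) t ⊆ W := by
      rintro x ⟨u, -, rfl⟩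
      exact hstay _ u.2 _
    exact hWw.2 _ hRW ((stab_EC hTr ht).congr fun x hxR ho => hag x (hRW hxR) ho)
  constructor
  · rintro ⟨φE, hE, hg⟩
    by_cases hx : (v0, m0) ∈ W
    · exact ⟨_, hSE, posStrat_fm up m0 v0 σ', fun φA hA _ => hin hx φA hA⟩
    · exact absurd (hg _ hSA) (hout hx φE hE)
  · rintro ⟨φE, hE, -, hg⟩
    by_cases hx : (v0, m0) ∈ W
    · exact ⟨_, hSE, hin hx⟩
    · exact absurd (hg _ hSA (posStrat_fm up m0 v0 π')) (hout hx φE hE)
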